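/- Let r ≥ 2, q a positive integer, λ an integer, and V ≥ 1. Define K_{r,q}(λ, V) as the number of tuples (v_1, …, v_{2r}) ∈ ℤ^{2r} with |v_i| ≤ V, each λ+v_i invertible mod q, and Σ_{i=1}^r (λ+v_i)^{−1} ≡ Σ_{i=r+1}^{2r} (λ+v_i)^{−1} (mod q). Then for every ε > 0 there is C(r, ε) such that whenever V ≤ q^{1/(4r(r−1))}, K_{r,q}(λ, V) ≤ C(r, ε)·V^r·q^ε. -/

import Mathlib

open scoped Classical in
/-- `K_{r,q}(λ, V)`: the number of tuples `(v_1, …, v_{2r})` with `|v_i| ≤ V`,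
each `λ + v_i` invertible mod `q`, and
`Σ_{i=1}^r (λ+v_i)⁻¹ ≡ Σ_{i=r+1}^{2r} (λ+v_i)⁻¹ (mod q)`. -/
noncomputable def Kcount (r q : ℕ) (lam : ℤ) (V : ℕ) : ℕ :=
  ((Fintype.piFinset (fun _ : Fin (r + r) => Finset.Icc (-(V : ℤ)) (V : ℤ))).filter
    (fun v : Fin (r + r) → ℤ =>
      (∀ i, IsUnit ((lam + v i : ℤ) : ZMod q)) ∧
      ∑ i : Fin r, (((lam + v (Fin.castAdd r i) : ℤ) : ZMod q))⁻¹ =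
        ∑ i : Fin r, (((lam + v (Fin.natAdd r i) : ℤ) : ZMod q))⁻¹)).card


namespace KL

/-- lcm of the `gcd (F x) (x - y)`, `y ∈ p`. -/
def lo (F : ℤ → ℤ) (p : Finset ℤ) (x : ℤ) : ℕ := p.lcm (fun y => Int.gcd (F x) (x - y))

/-- admissible moduli -/
def adm (F : ℤ → ℤ) (c m : ℕ) (p : Finset ℤ) (x : ℤ) : Finset ℕ :=
  (F x).natAbs.divisors.filter (fun M => lo F p x ∣ M ∧ (F x).natAbs ∣ c * M ^ m)

/-- weights -/
noncomputable def psi (F : ℤ → ℤ) (c m V : ℕ) (p : Finset ℤ) (x : ℤ) : ℝ :=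
  ∑ M ∈ adm F c m p x, ((lo F p x : ℝ) / M + (lo F p x : ℝ) / (lo F p x + V))

theorem psi_nonneg (F : ℤ → ℤ) (c m V : ℕ) (p : Finset ℤ) (x : ℤ) : 0 ≤ psi F c m V p x :=
  Finset.sum_nonneg fun _ _ => by positivity

theorem sum_prefix (G : Finset ℤ) (ψ : Finset ℤ → ℤ → ℝ) (hψ : ∀ p x, 0 ≤ ψ p x) (B : ℝ)
    (N : ℕ) (hB : ∀ p ⊆ G, p.card ≤ N → ∑ x ∈ G, ψ p x ≤ B) (hB0 : 0 ≤ B) (m : ℕ) :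
    ∀ p ⊆ G, p.card + m ≤ N → 
      ∑ v : Fin m → G, ∏ i, ψ (p ∪ (Finset.Iio i).image (fun j => (v j : ℤ))) (v i) ≤ B ^ m := by
  induction m with
  | zero => intro p _ _; simp
  | succ m ih =>
    intro p hp hc
    rw [← (Fin.consEquiv (fun _ : Fin (m + 1) => (G : Type))).sum_comp, Fintype.sum_prod_type]
    have hstep : ∀ x : G, ∑ v : Fin m → G, ∏ i, ψ (p ∪ (Finset.Iio i).image
        (fun j => ((Fin.consEquiv (fun _ : Fin (m + 1) => (G : Type)) (x, v)) j : ℤ)))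
        ((Fin.consEquiv (fun _ : Fin (m + 1) => (G : Type)) (x, v)) i) ≤ ψ p x * B ^ m := by
      intro x
      have := ih (insert (x : ℤ) p) (Finset.insert_subset x.2 hp)
        (by have := Finset.card_insert_le (x : ℤ) p; omega)
      refine le_trans (le_of_eq ?_) (mul_le_mul_of_nonneg_left this (hψ p x))
      rw [Finset.mul_sum]
      refine Finset.sum_congr rfl fun v _ => ?_
      rw [Fin.prod_univ_succ]
      have h0 : (Finset.Iio (0 : Fin (m + 1))) = ∅ := by ext; simp
      congr 1
      · simp [h0, Fin.consEquiv]
      · refine Finset.prod_congr rfl fun i _ => ?_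
        congr 1
        ext z
        simp only [Finset.mem_union, Finset.mem_image, Finset.mem_Iio, Finset.mem_insert]
        rw [Fin.exists_fin_succ]
        simp [Fin.consEquiv]
        grind
    calc _ ≤ ∑ x : G, ψ p x * B ^ m := Finset.sum_le_sum fun x _ => hstep x
      _ = (∑ x ∈ G, ψ p x) * B ^ m := by
        rw [Finset.sum_mul, ← Finset.sum_coe_sort G (fun x => ψ p x * B ^ m)]
      _ ≤ B * B ^ m := by
        gcongr
        exact hB p hp (by omega)
      _ = _ := by ring

theorem card_ap (V D : ℕ) (hD : 0 < D) (A : Finset ℤ) (hA : A ⊆ Finset.Icc (-(V : ℤ)) V)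
    (hc : ∀ x ∈ A, ∀ y ∈ A, (D : ℤ) ∣ x - y) : (A.card : ℝ) * D ≤ 2 * (D + V) := by
  have h1 : A.card ≤ (Finset.Icc (-(V : ℤ) / D) ((V : ℤ) / D)).card := by
    apply Finset.card_le_card_of_injOn (fun x => x / (D : ℤ))
    · intro x hx
      have := Finset.mem_Icc.mp (hA hx)
      simp only [Finset.coe_Icc, Set.mem_Icc]
      exact ⟨Int.ediv_le_ediv (by positivity) this.1, Int.ediv_le_ediv (by positivity) this.2⟩
    · intro x hx y hy hxy
      simp only at hxy
      have := hc x hx y hy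
      have e : x % D = y % D := Int.emod_eq_emod_iff_emod_sub_eq_zero.2 (Int.emod_eq_zero_of_dvd this)
      have a := Int.mul_ediv_add_emod x D
      have b := Int.mul_ediv_add_emod y D
      rw [← a, ← b, hxy, e]
  rw [Int.card_Icc] at h1
  have h2 : (-(V : ℤ) / D) * D > -(V : ℤ) - D := by
    have := Int.lt_ediv_add_one_mul_self (-(V : ℤ)) (show (0 : ℤ) < D by positivity)
    linarith
  have h3 : ((V : ℤ) / D) * D ≤ V := Int.ediv_mul_le _ (by positivity)
  have h4 : -(V : ℤ) / D ≤ (V : ℤ) / D := Int.ediv_le_ediv (by positivity) (by linarith [Int.natCast_nonneg V])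
  have h5 : (A.card : ℤ) ≤ (V : ℤ) / D + 1 - -(V : ℤ) / D := by omega
  have h6 : (A.card : ℤ) * D ≤ 2 * (D + V) := by
    calc (A.card : ℤ) * D ≤ ((V : ℤ) / D + 1 - -(V : ℤ) / D) * D := by gcongr
      _ ≤ _ := by linarith
  exact_mod_cast h6

theorem lo_pos (F : ℤ → ℤ) (p : Finset ℤ) (x : ℤ) (h : F x ≠ 0) : 0 < lo F p x := by
  rw [Nat.pos_iff_ne_zero, lo, Ne, Finset.lcm_eq_zero_iff]
  rintro ⟨y, -, hy⟩
  exact h (Int.gcd_eq_zero_iff.mp hy).1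

theorem gcd_dvd_left' (F : ℤ → ℤ) (hF : ∀ a b, a - b ∣ F a - F b) (x y : ℤ) :
    Int.gcd (F x) (x - y) ∣ (F y).natAbs := by
  rw [← Int.natCast_dvd]
  have h1 : (Int.gcd (F x) (x - y) : ℤ) ∣ F x := Int.gcd_dvd_left ..
  have h2 : (Int.gcd (F x) (x - y) : ℤ) ∣ F x - F y := (Int.gcd_dvd_right ..).trans (hF x y)
  have := dvd_sub h1 h2
  simpa using this

theorem lo_dvd_prod (F : ℤ → ℤ) (hF : ∀ a b, a - b ∣ F a - F b) (p : Finset ℤ) (x : ℤ) :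
    lo F p x ∣ ∏ y ∈ p, (F y).natAbs :=
  Finset.lcm_dvd fun y hy => (gcd_dvd_left' F hF x y).trans (Finset.dvd_prod_of_mem _ hy)

theorem part_two (F : ℤ → ℤ) (hF : ∀ a b, a - b ∣ F a - F b) (V : ℕ) (G : Finset ℤ)
    (hG : G ⊆ Finset.Icc (-(V : ℤ)) V) (hG0 : ∀ x ∈ G, F x ≠ 0)
    (T : ℝ) (hT1 : 1 ≤ T) (hT : ∀ x ∈ G, ((F x).natAbs.divisors.card : ℝ) ≤ T) (m : ℕ)
    (p : Finset ℤ) (hp : p ⊆ G) (hpm : p.card ≤ m) :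
    ∑ x ∈ G, (lo F p x : ℝ) / (lo F p x + V) ≤ 2 * T ^ m := by
  classical
  let key : ℤ → (p → ℕ) := fun x y => Int.gcd (F x) (x - y)
  let K : Finset (p → ℕ) := Fintype.piFinset fun y : p => (F y).natAbs.divisors
  have hmaps : ∀ x ∈ G, key x ∈ K := by
    intro x hx
    rw [Fintype.mem_piFinset]
    intro y
    rw [Nat.mem_divisors]
    exact ⟨gcd_dvd_left' F hF x y, by simpa using hG0 y (hp y.2)⟩
  rw [← Finset.sum_fiberwise_of_maps_to hmaps]
  have hfib : ∀ k ∈ K, ∑ x ∈ G with key x = k, (lo F p x : ℝ) / (lo F p x + V) ≤ 2 := by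
    intro k _
    rcases (G.filter (fun x => key x = k)).eq_empty_or_nonempty with h | ⟨x0, hx0⟩
    · rw [h]; simp
    rw [Finset.mem_filter] at hx0
    have hlo : ∀ x ∈ G.filter (fun x => key x = k), lo F p x = lo F p x0 := by
      intro x hx
      rw [Finset.mem_filter] at hx
      refine Finset.lcm_congr rfl fun y hy => ?_
      have := congrFun (hx.2.trans hx0.2.symm) ⟨y, hy⟩
      exact this
    rw [Finset.sum_congr rfl (fun x hx => by rw [hlo x hx]), Finset.sum_const, nsmul_eq_mul]
    have hpos := lo_pos F p x0 (hG0 x0 hx0.1)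
    have := card_ap V (lo F p x0) hpos (G.filter (fun x => key x = k))
      ((Finset.filter_subset _ _).trans hG) (by
        intro x hx y hy
        rw [Int.natCast_dvd]
        refine Finset.lcm_dvd fun z hz => ?_
        rw [← Int.natCast_dvd]
        rw [Finset.mem_filter] at hx hy
        have e1 : Int.gcd (F x) (x - z) = Int.gcd (F x0) (x0 - z) :=
          congrFun (hx.2.trans hx0.2.symm) ⟨z, hz⟩
        have e2 : Int.gcd (F y) (y - z) = Int.gcd (F x0) (x0 - z) :=
          congrFun (hy.2.trans hx0.2.symm) ⟨z, hz⟩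
        have d1 : (Int.gcd (F x) (x - z) : ℤ) ∣ x - z := Int.gcd_dvd_right ..
        have d2 : (Int.gcd (F y) (y - z) : ℤ) ∣ y - z := Int.gcd_dvd_right ..
        rw [e1] at d1
        rw [e2] at d2
        have := dvd_sub d1 d2
        simpa using this)
    have hpos' : (0 : ℝ) < lo F p x0 := by exact_mod_cast hpos
    rw [← mul_div_assoc, div_le_iff₀ (by positivity)]
    linarith
  calc _ ≤ ∑ k ∈ K, (2 : ℝ) := Finset.sum_le_sum hfib
    _ = 2 * K.card := by rw [Finset.sum_const, nsmul_eq_mul, mul_comm]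
    _ ≤ 2 * T ^ m := by
      gcongr
      rw [Fintype.card_piFinset]
      push_cast
      calc _ ≤ ∏ y : p, T := Finset.prod_le_prod (fun _ _ => by positivity) fun y _ => hT y (hp y.2)
        _ = T ^ p.card := by simp
        _ ≤ T ^ m := pow_le_pow_right₀ hT1 hpm

theorem count_dvd (F : ℤ → ℤ) (G : Finset ℤ) (dd : ℕ)
    (hdd : ∀ n : ℤ, (G.filter (fun x => F x = n)).card ≤ dd) (N : ℕ) (hN : N ≠ 0) :
    (G.filter (fun x => (F x).natAbs ∣ N)).card ≤ 2 * dd * N.divisors.card := by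
  classical
  have hsub : G.filter (fun x => (F x).natAbs ∣ N) ⊆
      N.divisors.biUnion (fun n => G.filter (fun x => F x = n) ∪ G.filter (fun x => F x = -n)) := by
    intro x hx
    rw [Finset.mem_filter] at hx
    rw [Finset.mem_biUnion]
    refine ⟨(F x).natAbs, Nat.mem_divisors.2 ⟨hx.2, hN⟩, ?_⟩
    rw [Finset.mem_union, Finset.mem_filter, Finset.mem_filter]
    have := Int.natAbs_eq (F x)
    tauto
  calc _ ≤ _ := Finset.card_le_card hsub
    _ ≤ N.divisors.card * (2 * dd) := by
      apply Finset.card_biUnion_le_card_mul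
      intro n _
      refine (Finset.card_union_le _ _).trans ?_
      have := hdd n
      have := hdd (-n)
      omega
    _ = _ := by ring

theorem part_one (F : ℤ → ℤ) (hF : ∀ a b, a - b ∣ F a - F b) (c m X dd Y : ℕ) (hc : c ≠ 0)
    (G : Finset ℤ)
    (hG0 : ∀ x ∈ G, F x ≠ 0) (hX : ∀ x ∈ G, (F x).natAbs ≤ X) (hX1 : 1 ≤ X)
    (hdd : ∀ n : ℤ, (G.filter (fun x => F x = n)).card ≤ dd)
    (T : ℝ) (hT : ∀ n : ℕ, n ≠ 0 → n ≤ Y → (n.divisors.card : ℝ) ≤ T)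
    (hY1 : X ^ m ≤ Y) (hY2 : c * (X ^ m * X) ^ m ≤ Y)
    (p : Finset ℤ) (hp : p ⊆ G) (hpm : p.card ≤ m) :
    ∑ x ∈ G, ∑ M ∈ adm F c m p x, (lo F p x : ℝ) / M ≤ T * ((1 + Real.log X) * (2 * dd * T)) := by
  classical
  have hT0 : 0 ≤ T := le_trans (by positivity) (hT 1 one_ne_zero (le_trans (Nat.one_le_pow _ _ hX1) hY1))
  set L : ℕ := ∏ y ∈ p, (F y).natAbs with hL
  have hL0 : L ≠ 0 := Finset.prod_ne_zero_iff.2 fun y hy => by simpa using hG0 y (hp hy)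
  have hLX : L ≤ X ^ m :=
    (Finset.prod_le_pow_card _ _ _ fun y hy => hX y (hp hy)).trans (Nat.pow_le_pow_right hX1 hpm)
  let g : ℤ → ℕ → ℕ → ℝ := fun x D k => if (F x).natAbs ∣ c * (D * k) ^ m then (k : ℝ)⁻¹ else 0
  have hg0 : ∀ x D k, 0 ≤ g x D k := fun x D k => by
    simp only [g]; split_ifs <;> positivity
  have h1 : ∀ x ∈ G, ∑ M ∈ adm F c m p x, (lo F p x : ℝ) / M ≤
      ∑ D ∈ L.divisors, ∑ k ∈ Finset.Icc 1 X, g x D k := by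
    intro x hx
    have hlo := lo_pos F p x (hG0 x hx)
    have hmem : lo F p x ∈ L.divisors := Nat.mem_divisors.2 ⟨lo_dvd_prod F hF p x, hL0⟩
    refine le_trans ?_ (Finset.single_le_sum (f := fun D => ∑ k ∈ Finset.Icc 1 X, g x D k)
      (fun D _ => Finset.sum_nonneg fun k _ => hg0 x D k) hmem)
    have hinj : Set.InjOn (fun M => M / lo F p x) (adm F c m p x : Set ℕ) := by
      intro M hM M' hM' h
      simp only [adm, Finset.coe_filter, Set.mem_ofPred_eq] at hM hM'
      exact (Nat.div_left_inj hM.2.1 hM'.2.1).1 h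
    calc ∑ M ∈ adm F c m p x, (lo F p x : ℝ) / M
        = ∑ M ∈ adm F c m p x, g x (lo F p x) (M / lo F p x) := by
          refine Finset.sum_congr rfl fun M hM => ?_
          simp only [adm, Finset.mem_filter, Nat.mem_divisors] at hM
          obtain ⟨⟨hM1, hM2⟩, ⟨k, rfl⟩, hM4⟩ := hM
          have hk : k ≠ 0 := by rintro rfl; simp at hM1; omega
          have hl : (lo F p x : ℝ) ≠ 0 := by positivity
          simp only [g]
          rw [Nat.mul_div_cancel_left _ hlo, if_pos hM4]
          push_cast
          field_simp
      _ = ∑ k ∈ (adm F c m p x).image (fun M => M / lo F p x), g x (lo F p x) k := by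
          rw [Finset.sum_image hinj]
      _ ≤ _ := by
          refine Finset.sum_le_sum_of_subset_of_nonneg ?_ fun _ _ _ => hg0 _ _ _
          intro k hk
          rw [Finset.mem_image] at hk
          obtain ⟨M, hM, rfl⟩ := hk
          simp only [adm, Finset.mem_filter, Nat.mem_divisors] at hM
          have hMp : 0 < M := Nat.pos_of_dvd_of_pos hM.1.1 (Nat.pos_of_ne_zero hM.1.2)
          rw [Finset.mem_Icc]
          constructor
          · exact Nat.div_pos (Nat.le_of_dvd hMp hM.2.1) hlo
          · exact (Nat.div_le_self _ _).trans ((Nat.le_of_dvd (Nat.pos_of_ne_zero hM.1.2) hM.1.1).trans (hX x hx))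
  calc _ ≤ ∑ x ∈ G, ∑ D ∈ L.divisors, ∑ k ∈ Finset.Icc 1 X, g x D k := Finset.sum_le_sum h1
    _ = ∑ D ∈ L.divisors, ∑ k ∈ Finset.Icc 1 X, ∑ x ∈ G, g x D k := by
      rw [Finset.sum_comm]
      refine Finset.sum_congr rfl fun D _ => ?_
      rw [Finset.sum_comm]
    _ ≤ ∑ D ∈ L.divisors, ∑ k ∈ Finset.Icc 1 X, (k : ℝ)⁻¹ * (2 * dd * T) := by
      refine Finset.sum_le_sum fun D hD => Finset.sum_le_sum fun k hk => ?_
      simp only [g]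
      rw [← Finset.sum_filter, Finset.sum_const, nsmul_eq_mul, mul_comm]
      rw [Nat.mem_divisors] at hD
      rw [Finset.mem_Icc] at hk
      have hDp : 0 < D := Nat.pos_of_dvd_of_pos hD.1 (Nat.pos_of_ne_zero hD.2)
      have hne : c * (D * k) ^ m ≠ 0 := by
        have : 0 < k := hk.1
        positivity
      have hle : c * (D * k) ^ m ≤ Y := by
        refine le_trans ?_ hY2
        have := (Nat.le_of_dvd (Nat.pos_of_ne_zero hL0) hD.1).trans hLX
        gcongr
        exact hk.2
      have h2 := count_dvd F G dd hdd _ hne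
      have h3 := hT _ hne hle
      have h4 : ((G.filter (fun x => (F x).natAbs ∣ c * (D * k) ^ m)).card : ℝ) ≤ 
          2 * dd * (c * (D * k) ^ m).divisors.card := by exact_mod_cast h2
      gcongr
      refine h4.trans ?_
      gcongr
    _ = L.divisors.card * ((∑ k ∈ Finset.Icc 1 X, (k : ℝ)⁻¹) * (2 * dd * T)) := by
      rw [Finset.sum_const, nsmul_eq_mul, Finset.sum_mul]
    _ ≤ _ := by
      have h5 := hT L hL0 (hLX.trans hY1)
      have h6 : (∑ k ∈ Finset.Icc 1 X, (k : ℝ)⁻¹) ≤ 1 + Real.log X := by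
        have := harmonic_le_one_add_log X
        rw [harmonic_eq_sum_Icc] at this
        push_cast at this
        exact this
      have : 0 ≤ Real.log X := Real.log_natCast_nonneg X
      gcongr

theorem psi_sum (F : ℤ → ℤ) (hF : ∀ a b, a - b ∣ F a - F b) (c m V X dd Y : ℕ) (hc : c ≠ 0)
    (G : Finset ℤ) (hG : G ⊆ Finset.Icc (-(V : ℤ)) V)
    (hG0 : ∀ x ∈ G, F x ≠ 0) (hX : ∀ x ∈ G, (F x).natAbs ≤ X) (hX1 : 1 ≤ X)
    (hdd : ∀ n : ℤ, (G.filter (fun x => F x = n)).card ≤ dd)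
    (T : ℝ) (hT1 : 1 ≤ T) (hT : ∀ n : ℕ, n ≠ 0 → n ≤ Y → (n.divisors.card : ℝ) ≤ T)
    (hY0 : X ≤ Y) (hY1 : X ^ m ≤ Y) (hY2 : c * (X ^ m * X) ^ m ≤ Y)
    (p : Finset ℤ) (hp : p ⊆ G) (hpm : p.card ≤ m) :
    ∑ x ∈ G, psi F c m V p x ≤
      T * ((1 + Real.log X) * (2 * dd * T)) + T * (2 * T ^ m) := by
  have hTF : ∀ x ∈ G, ((F x).natAbs.divisors.card : ℝ) ≤ T := fun x hx =>
    hT _ (by simpa using hG0 x hx) ((hX x hx).trans hY0)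
  have h1 := part_one F hF c m X dd Y hc G hG0 hX hX1 hdd T hT hY1 hY2 p hp hpm
  have h2 := part_two F hF V G hG hG0 T hT1 hTF m p hp hpm
  simp only [psi, Finset.sum_add_distrib]
  refine add_le_add h1 ?_
  refine le_trans ?_ (mul_le_mul_of_nonneg_left h2 (by linarith))
  rw [Finset.mul_sum]
  refine Finset.sum_le_sum fun x hx => ?_
  rw [Finset.sum_const, nsmul_eq_mul]
  gcongr
  refine le_trans ?_ (hTF x hx)
  exact_mod_cast Finset.card_filter_le _ _

/-- Divisor bound. -/
theorem tau_bound (δ : ℝ) (hδ : 0 < δ) :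
    ∃ C : ℝ, 1 ≤ C ∧ ∀ n : ℕ, n ≠ 0 → (n.divisors.card : ℝ) ≤ C * (n : ℝ) ^ δ := by
  obtain ⟨P, hP⟩ := exists_nat_gt ((2 : ℝ) ^ (1 / δ))
  have hlog : 0 < δ * Real.log 2 := mul_pos hδ (Real.log_pos (by norm_num))
  obtain ⟨K, hK1, hK⟩ : ∃ K : ℝ, 1 ≤ K ∧ ∀ a : ℕ, (a : ℝ) + 1 ≤ K * (2 : ℝ) ^ (δ * a) := by
    refine ⟨1 + 1 / (δ * Real.log 2), by
      have : 0 < 1 / (δ * Real.log 2) := by positivity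
      linarith, fun a => ?_⟩
    have h1 : (2 : ℝ) ^ (δ * a) = Real.exp (δ * Real.log 2 * a) := by
      rw [Real.rpow_def_of_pos (by norm_num)]; ring_nf
    have h2 := Real.add_one_le_exp (δ * Real.log 2 * a)
    rw [h1]
    have h3 : (a : ℝ) = 1 / (δ * Real.log 2) * (δ * Real.log 2 * a) := by
      field_simp
    have h4 : 0 ≤ δ * Real.log 2 * a := by positivity
    have h5 : 0 < 1 / (δ * Real.log 2) := by positivity
    nlinarith
  refine ⟨K ^ P, one_le_pow₀ hK1, fun n hn => ?_⟩
  rw [Nat.card_divisors hn]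
  have hn' : (n : ℝ) ^ δ = ∏ p ∈ n.primeFactors, ((p : ℝ) ^ (δ * n.factorization p)) := by
    conv_lhs => rw [← Nat.prod_factorization_pow_eq_self hn]
    rw [Finsupp.prod, Nat.support_factorization]
    push_cast
    rw [← Real.finsetProd_rpow _ _ (fun i _ => by positivity)]
    refine Finset.prod_congr rfl fun p _ => ?_
    rw [← Real.rpow_natCast, ← Real.rpow_mul (by positivity), mul_comm]
  have key : ∀ p ∈ n.primeFactors, ((n.factorization p + 1 : ℕ) : ℝ) ≤
      (if p < P then K else 1) * (p : ℝ) ^ (δ * n.factorization p) := by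
    intro p hp
    have hp2 : (2 : ℝ) ≤ p := by exact_mod_cast (Nat.prime_of_mem_primeFactors hp).two_le
    split_ifs with h
    · push_cast
      refine (hK _).trans ?_
      gcongr
    · push_cast
      have h1 : (2 : ℝ) ≤ (p : ℝ) ^ δ := by
        have : (2 : ℝ) = ((2 : ℝ) ^ (1 / δ)) ^ δ := by
          rw [← Real.rpow_mul (by norm_num)]; field_simp; simp
        rw [this]
        have : (P : ℝ) ≤ p := by exact_mod_cast not_lt.mp h
        gcongr
        linarith
      rw [one_mul, Real.rpow_mul (by positivity), Real.rpow_natCast]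
      calc ((n.factorization p : ℝ) + 1) ≤ 2 ^ (n.factorization p) := by
            exact_mod_cast Nat.lt_two_pow_self
        _ ≤ _ := by gcongr
  push_cast at key ⊢
  calc _ ≤ ∏ p ∈ n.primeFactors, ((if p < P then K else 1) * (p : ℝ) ^ (δ * n.factorization p)) :=
        Finset.prod_le_prod (fun _ _ => by positivity) key
    _ = (∏ p ∈ n.primeFactors, (if p < P then K else 1)) * (n : ℝ) ^ δ := by
        rw [Finset.prod_mul_distrib, hn']
    _ ≤ _ := by
        gcongr
        rw [← Finset.prod_filter, Finset.prod_const]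
        apply pow_le_pow_right₀ hK1
        calc _ ≤ (Finset.range P).card := by
              apply Finset.card_le_card
              intro x hx
              simp at hx ⊢
              exact hx.2
          _ = P := by simp


/-- pointwise weight -/
noncomputable def phi (V lo M : ℕ) : ℝ := (lo : ℝ) / M + (lo : ℝ) / (lo + V)

theorem phi_nonneg (V lo M : ℕ) : 0 ≤ phi V lo M := by unfold phi; positivity

theorem phi_mul (V a b M : ℕ) (hV : 1 ≤ V) (ha : 0 < a) (hb : 0 < b) (hM : 0 < M)
    (hab : M ≤ a * b) : 1 / (4 * (V : ℝ)) ≤ phi V a M * phi V b M := by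
  have hV' : (1 : ℝ) ≤ V := by exact_mod_cast hV
  have ha' : (1 : ℝ) ≤ a := by exact_mod_cast ha
  have hb' : (1 : ℝ) ≤ b := by exact_mod_cast hb
  have hM' : (0 : ℝ) < M := by exact_mod_cast hM
  have hab' : (M : ℝ) ≤ a * b := by exact_mod_cast hab
  unfold phi
  rcases le_total (M : ℝ) V with h | h
  · calc 1 / (4 * (V : ℝ)) ≤ ((a : ℝ) / M) * ((b : ℝ) / M) := by
          rw [div_mul_div_comm, div_le_div_iff₀ (by positivity) (by positivity)]
          nlinarith [mul_le_mul hab' h hM'.le (by positivity), mul_pos hM' hM']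
      _ ≤ _ := by gcongr <;> (apply le_add_of_nonneg_right; positivity)
  · have key : 1 / (4 * (V : ℝ)) ≤ ((a : ℝ) / (a + V)) * ((b : ℝ) / (b + V)) := by
      rw [div_mul_div_comm, div_le_div_iff₀ (by positivity) (by positivity)]
      have : (V : ℝ) ≤ a * b := h.trans hab'
      rcases le_total (a : ℝ) V with h1 | h1 <;> rcases le_total (b : ℝ) V with h2 | h2 <;>
        nlinarith [mul_nonneg (sub_nonneg.2 ha') (sub_nonneg.2 hb'), mul_nonneg (sub_nonneg.2 ha') (sub_nonneg.2 hV'), mul_nonneg (sub_nonneg.2 hb') (sub_nonneg.2 hV'), mul_nonneg (sub_nonneg.2 h1) (sub_nonneg.2 h2), mul_nonneg (mul_nonneg (sub_nonneg.2 ha') (sub_nonneg.2 hb')) (sub_nonneg.2 hV'), mul_nonneg (sub_nonneg.2 h1) (sub_nonneg.2 hb'), mul_nonneg (sub_nonneg.2 h2) (sub_nonneg.2 ha'), mul_nonneg (mul_nonneg (sub_nonneg.2 h1) (sub_nonneg.2 hb')) (sub_nonneg.2 hV'), mul_nonneg (mul_nonneg (sub_nonneg.2 h2) (sub_nonneg.2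 ha')) (sub_nonneg.2 hV')]
    refine key.trans ?_
    gcongr <;> (apply le_add_of_nonneg_left; positivity)

theorem dvd_prod_gcd {ι : Type*} (s : Finset ι) (k M : ℕ) (x : ι → ℕ) :
    (∀ j ∈ s, Nat.gcd k (x j) ∣ M) → ∀ c : ℕ, k ∣ c * ∏ j ∈ s, x j → k ∣ c * M ^ s.card := by
  classical
  induction s using Finset.induction_on with
  | empty => intro _ c h; simpa using h
  | insert j s hj ih =>
    intro h c hk
    rw [Finset.prod_insert hj] at hk
    rw [Finset.card_insert_of_notMem hj, pow_succ']
    rw [← mul_assoc]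
    apply ih (fun i hi => h i (Finset.mem_insert_of_mem hi))
    have h1 : k ∣ x j * (c * ∏ i ∈ s, x i) := by
      convert hk using 1; ring
    have h2 := Nat.dvd_gcd_mul_iff_dvd_mul.2 h1
    have h3 := h2.trans (Nat.mul_dvd_mul (h j (Finset.mem_insert_self _ _)) (dvd_refl _))
    rw [show c * M * ∏ i ∈ s, x i = M * (c * ∏ i ∈ s, x i) by ring]
    exact h3

/-- The property of tuples. -/
def Good (F : ℤ → ℤ) (c V m : ℕ) (v : Fin m → ℤ) : Prop :=
  (∀ i, v i ∈ Finset.Icc (-(V : ℤ)) V) ∧ Function.Injective v ∧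
    ∀ i, F (v i) ∣ c * ∏ j ∈ Finset.univ.erase i, (v j - v i)

/-- modulus of all -/
def Mv (F : ℤ → ℤ) {m : ℕ} (v : Fin m → ℤ) (i : Fin m) : ℕ :=
  lo F ((Finset.univ.erase i).image v) (v i)

theorem Good.ne_zero {F : ℤ → ℤ} {c V m : ℕ} (hc : c ≠ 0) {v : Fin m → ℤ} (h : Good F c V m v)
    (i : Fin m) : F (v i) ≠ 0 := by
  intro h0
  have := h.2.2 i
  rw [h0, zero_dvd_iff] at this
  have hne : (c : ℤ) * ∏ j ∈ Finset.univ.erase i, (v j - v i) ≠ 0 := by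
    apply mul_ne_zero (by exact_mod_cast hc)
    rw [Finset.prod_ne_zero_iff]
    intro j hj h'
    exact (Finset.ne_of_mem_erase hj) (h.2.1 (sub_eq_zero.1 h'))
  exact hne this

theorem Good.natAbs_dvd {F : ℤ → ℤ} {c V m : ℕ} {v : Fin m → ℤ} (h : Good F c V m v)
    (i : Fin m) : (F (v i)).natAbs ∣ c * ∏ j ∈ Finset.univ.erase i, (v j - v i).natAbs := by
  have := Int.natAbs_dvd_natAbs.2 (h.2.2 i)
  have e : (∏ j ∈ Finset.univ.erase i, (v j - v i)).natAbs =
      ∏ j ∈ Finset.univ.erase i, (v j - v i).natAbs := map_prod Int.natAbsHom _ _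
  rw [Int.natAbs_mul, e, Int.natAbs_natCast] at this
  exact this

theorem Good.le {F : ℤ → ℤ} {c V m : ℕ} (hc : c ≠ 0) (hV : 1 ≤ V) {v : Fin m → ℤ}
    (h : Good F c V m v)
    (i : Fin m) : (F (v i)).natAbs ≤ c * (2 * V) ^ m := by
  have h1 := h.natAbs_dvd i
  have hpos : 0 < c * ∏ j ∈ Finset.univ.erase i, (v j - v i).natAbs := by
    apply Nat.mul_pos (Nat.pos_of_ne_zero hc)
    apply Finset.prod_pos
    intro j hj
    rw [Int.natAbs_pos, sub_ne_zero]
    exact fun h' => (Finset.ne_of_mem_erase hj) (h.2.1 h')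
  refine (Nat.le_of_dvd hpos h1).trans ?_
  gcongr
  calc _ ≤ (2 * V) ^ (Finset.univ.erase i).card := by
        apply Finset.prod_le_pow_card
        intro j _
        have a := Finset.mem_Icc.1 (h.1 i)
        have b := Finset.mem_Icc.1 (h.1 j)
        omega
    _ ≤ _ := by
        apply Nat.pow_le_pow_right (by omega)
        exact (Finset.card_le_univ _).trans (by simp)

theorem Good.adm {F : ℤ → ℤ} {c V m : ℕ} (hc : c ≠ 0) {v : Fin m → ℤ}
    (h : Good F c V m v) (i : Fin m) :
    Mv F v i ∈ adm F c m ((Finset.Iio i).image v) (v i) := by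
  unfold KL.adm Mv lo
  rw [Finset.mem_filter, Nat.mem_divisors]
  refine ⟨⟨?_, by simpa using h.ne_zero hc i⟩, ?_, ?_⟩
  · exact Finset.lcm_dvd fun y _ => by rw [Int.gcd_def]; exact Nat.gcd_dvd_left _ _
  · refine Finset.lcm_mono (f := fun y => Int.gcd (F (v i)) (v i - y)) ?_
    apply Finset.image_subset_image
    intro j hj
    have := Finset.mem_Iio.1 hj
    simp [this.ne]
  · change (F (v i)).natAbs ∣ c * (Mv F v i) ^ m
    have h1 := dvd_prod_gcd (Finset.univ.erase i) (F (v i)).natAbs (Mv F v i)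
      (fun j => (v j - v i).natAbs) (by
        intro j hj
        have : (F (v i)).gcd (v i - v j) ∣ Mv F v i :=
          Finset.dvd_lcm (f := fun y => (F (v i)).gcd (v i - y))
            (Finset.mem_image_of_mem v hj)
        rw [Int.gcd_def, ← neg_sub, Int.natAbs_neg] at this
        exact this) c (h.natAbs_dvd i)
    refine h1.trans (Nat.mul_dvd_mul_left _ (pow_dvd_pow _ ?_))
    exact (Finset.card_le_univ _).trans (by simp)

theorem forward (F : ℤ → ℤ) (c m V : ℕ) (hc : c ≠ 0) (hV : 1 ≤ V) (B : ℝ) (hB0 : 0 ≤ B)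
    (hB : ∀ p ⊆ (Finset.Icc (-(V : ℤ)) V).filter
      (fun x => F x ≠ 0 ∧ (F x).natAbs ≤ c * (2 * V) ^ m), p.card ≤ m →
      ∑ x ∈ (Finset.Icc (-(V : ℤ)) V).filter
        (fun x => F x ≠ 0 ∧ (F x).natAbs ≤ c * (2 * V) ^ m), psi F c m V p x ≤ B)
    (S : Finset (Fin m → ℤ)) (hS : ∀ v ∈ S, Good F c V m v) :
    ∑ v ∈ S, ∏ i, phi V (lo F ((Finset.Iio i).image v) (v i)) (Mv F v i) ≤ B ^ m := by
  classical
  set G := (Finset.Icc (-(V : ℤ)) V).filter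
      (fun x => F x ≠ 0 ∧ (F x).natAbs ≤ c * (2 * V) ^ m) with hG
  have h1 := sum_prefix G (psi F c m V) (psi_nonneg F c m V) B m hB hB0 m ∅ (by simp) (by simp)
  refine le_trans ?_ h1
  have hmem : ∀ v ∈ S, ∀ i, v i ∈ G := fun v hv i => by
    rw [hG, Finset.mem_filter]
    exact ⟨(hS v hv).1 i, (hS v hv).ne_zero hc i, (hS v hv).le hc hV i⟩
  let emb : (Fin m → G) → (Fin m → ℤ) := fun w i => w i
  have hemb : Function.Injective emb := fun a b hab => by
    funext i; exact Subtype.ext (congrFun hab i)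
  calc _ ≤ ∑ v ∈ S, ∏ i, psi F c m V ((Finset.Iio i).image v) (v i) := by
        refine Finset.sum_le_sum fun v hv => Finset.prod_le_prod (fun _ _ => phi_nonneg _ _ _) ?_
        intro i _
        exact Finset.single_le_sum (f := fun M => phi V (lo F ((Finset.Iio i).image v) (v i)) M)
          (fun _ _ => phi_nonneg _ _ _) ((hS v hv).adm hc i)
    _ ≤ ∑ v ∈ Finset.univ.image emb, ∏ i, psi F c m V ((Finset.Iio i).image v) (v i) := by
        apply Finset.sum_le_sum_of_subset_of_nonneg
        · intro v hv
          rw [Finset.mem_image]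
          exact ⟨fun i => ⟨v i, hmem v hv i⟩, Finset.mem_univ _, rfl⟩
        · intro v _ _
          exact Finset.prod_nonneg fun _ _ => psi_nonneg _ _ _ _ _ _
    _ = _ := by
        rw [Finset.sum_image hemb.injOn]
        simp [emb]

theorem both (F : ℤ → ℤ) (c m V : ℕ) (hc : c ≠ 0) (hV : 1 ≤ V) (B : ℝ) (hB0 : 0 ≤ B)
    (hB : ∀ p ⊆ (Finset.Icc (-(V : ℤ)) V).filter
      (fun x => F x ≠ 0 ∧ (F x).natAbs ≤ c * (2 * V) ^ m), p.card ≤ m →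
      ∑ x ∈ (Finset.Icc (-(V : ℤ)) V).filter
        (fun x => F x ≠ 0 ∧ (F x).natAbs ≤ c * (2 * V) ^ m), psi F c m V p x ≤ B)
    (S : Finset (Fin m → ℤ)) (hS : ∀ v ∈ S, Good F c V m v) :
    (S.card : ℝ) * Real.sqrt ((1 / (4 * (V : ℝ))) ^ m) ≤ B ^ m := by
  classical
  have hinj : Function.Injective (fun (v : Fin m → ℤ) => v ∘ Fin.rev) := by
    intro a b h
    funext i
    have := congrFun h (Fin.rev i)
    simpa using this
  have him : ∀ (v : Fin m → ℤ) (i : Fin m), (Finset.univ.erase (Fin.rev i)).image (v ∘ Fin.rev) =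
      (Finset.univ.erase i).image v := by
    intro v i
    ext z
    simp only [Finset.mem_image, Finset.mem_erase, Finset.mem_univ, and_true, Function.comp]
    constructor
    · rintro ⟨j, hj, rfl⟩
      exact ⟨Fin.rev j, fun h => hj (by rw [← h, Fin.rev_rev]), rfl⟩
    · rintro ⟨j, hj, rfl⟩
      exact ⟨Fin.rev j, fun h => hj (Fin.rev_injective h), by rw [Fin.rev_rev]⟩
  have him2 : ∀ (v : Fin m → ℤ) (i : Fin m), (Finset.Iio (Fin.rev i)).image (v ∘ Fin.rev) =
      (Finset.Ioi i).image v := by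
    intro v i
    ext z
    simp only [Finset.mem_image, Finset.mem_Iio, Finset.mem_Ioi, Function.comp]
    constructor
    · rintro ⟨j, hj, rfl⟩
      exact ⟨Fin.rev j, by rw [← Fin.rev_rev i]; exact Fin.rev_lt_rev.2 hj, rfl⟩
    · rintro ⟨j, hj, rfl⟩
      exact ⟨Fin.rev j, Fin.rev_lt_rev.2 hj, by rw [Fin.rev_rev]⟩
  have hS' : ∀ v ∈ S.image (fun v => v ∘ Fin.rev), Good F c V m v := by
    intro v hv
    obtain ⟨w, hw, rfl⟩ := Finset.mem_image.1 hv
    obtain ⟨h1, h2, h3⟩ := hS w hw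
    refine ⟨fun i => h1 _, h2.comp Fin.rev_injective, fun i => ?_⟩
    have := h3 (Fin.rev i)
    change F (w (Fin.rev i)) ∣ c * ∏ j ∈ Finset.univ.erase i, (w (Fin.rev j) - w (Fin.rev i))
    suffices e : ∏ j ∈ Finset.univ.erase i, (w (Fin.rev j) - w (Fin.rev i)) =
        ∏ j ∈ Finset.univ.erase (Fin.rev i), (w j - w (Fin.rev i)) by rw [e]; exact this
    refine Finset.prod_bij (fun j _ => Fin.rev j) ?_ ?_ ?_ ?_
    · intro j hj
      simpa using hj
    · intro a _ b _ h
      exact Fin.rev_injective h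
    · intro b hb
      refine ⟨Fin.rev b, ?_, Fin.rev_rev b⟩
      simp only [Finset.mem_erase, Finset.mem_univ, and_true] at hb ⊢
      exact fun h => hb (by rw [← h, Fin.rev_rev])
    · intro j _
      rfl
  have f1 := forward F c m V hc hV B hB0 hB S hS
  have f2 := forward F c m V hc hV B hB0 hB _ hS'
  rw [Finset.sum_image hinj.injOn] at f2
  have f3 : ∑ v ∈ S, ∏ i, phi V (lo F ((Finset.Ioi i).image v) (v i)) (Mv F v i) ≤ B ^ m := by
    refine le_trans (le_of_eq ?_) f2
    refine Finset.sum_congr rfl fun v _ => ?_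
    rw [← Equiv.prod_comp Fin.revPerm
      (fun i => phi V (lo F ((Finset.Ioi i).image v) (v i)) (Mv F v i))]
    refine Finset.prod_congr rfl fun i _ => ?_
    have e1 := him2 v (Fin.rev i)
    have e2 := him v (Fin.rev i)
    rw [Fin.rev_rev] at e1 e2
    simp only [Fin.revPerm_apply, Mv, e1, e2, Function.comp_apply]
  have key : ∀ v ∈ S, Real.sqrt ((1 / (4 * (V : ℝ))) ^ m) ≤
      ((∏ i, phi V (lo F ((Finset.Iio i).image v) (v i)) (Mv F v i)) +
      (∏ i, phi V (lo F ((Finset.Ioi i).image v) (v i)) (Mv F v i))) / 2 := by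
    intro v hv
    have hne := fun i => (hS v hv).ne_zero hc i
    have hA : 0 ≤ ∏ i, phi V (lo F ((Finset.Iio i).image v) (v i)) (Mv F v i) :=
      Finset.prod_nonneg fun _ _ => phi_nonneg _ _ _
    have hB : 0 ≤ ∏ i, phi V (lo F ((Finset.Ioi i).image v) (v i)) (Mv F v i) :=
      Finset.prod_nonneg fun _ _ => phi_nonneg _ _ _
    have hAB : (1 / (4 * (V : ℝ))) ^ m ≤
        (∏ i, phi V (lo F ((Finset.Iio i).image v) (v i)) (Mv F v i)) *
      (∏ i, phi V (lo F ((Finset.Ioi i).image v) (v i)) (Mv F v i)) := by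
      rw [← Finset.prod_mul_distrib]
      calc (1 / (4 * (V : ℝ))) ^ m = ∏ i : Fin m, (1 / (4 * (V : ℝ))) := by simp
        _ ≤ _ := by
          refine Finset.prod_le_prod (fun _ _ => by positivity) fun i _ => ?_
          have p1 := lo_pos F ((Finset.Iio i).image v) (v i) (hne i)
          have p2 := lo_pos F ((Finset.Ioi i).image v) (v i) (hne i)
          apply phi_mul V _ _ _ hV p1 p2 (lo_pos _ _ _ (hne i))
          refine Nat.le_of_dvd (Nat.mul_pos p1 p2) (Finset.lcm_dvd fun y hy => ?_)
          obtain ⟨j, hj, rfl⟩ := Finset.mem_image.1 hy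
          rcases lt_or_gt_of_ne (Finset.ne_of_mem_erase hj) with h | h
          · exact Dvd.dvd.mul_right (Finset.dvd_lcm (f := fun y => (F (v i)).gcd (v i - y))
              (Finset.mem_image_of_mem v (Finset.mem_Iio.2 h))) _
          · exact Dvd.dvd.mul_left (Finset.dvd_lcm (f := fun y => (F (v i)).gcd (v i - y))
              (Finset.mem_image_of_mem v (Finset.mem_Ioi.2 h))) _
    rw [Real.sqrt_le_left (by positivity)]
    nlinarith [sq_nonneg ((∏ i, phi V (lo F ((Finset.Iio i).image v) (v i)) (Mv F v i)) -
      (∏ i, phi V (lo F ((Finset.Ioi i).image v) (v i)) (Mv F v i)))]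
  calc _ = ∑ v ∈ S, Real.sqrt ((1 / (4 * (V : ℝ))) ^ m) := by rw [Finset.sum_const, nsmul_eq_mul]
    _ ≤ _ := Finset.sum_le_sum key
    _ ≤ B ^ m := by
      rw [← Finset.sum_div, Finset.sum_add_distrib]
      linarith

theorem count_core (m dd c : ℕ) (hc : c ≠ 0) (ε : ℝ) (hε : 0 < ε) :
    ∃ K : ℝ, 0 < K ∧ ∀ V : ℕ, 1 ≤ V → ∀ F : ℤ → ℤ, (∀ a b, a - b ∣ F a - F b) →
      (∀ n : ℤ, ((Finset.Icc (-(V : ℤ)) V).filter (fun x => F x = n)).card ≤ dd) →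
      ∀ S : Finset (Fin m → ℤ), (∀ v ∈ S, Good F c V m v) →
      (S.card : ℝ) ≤ K * (V : ℝ) ^ ((m : ℝ) / 2 + ε) := by
  set E : ℕ := m * (m + 1) ^ 2 with hE
  set W : ℕ := m * (m + 3) with hW
  set δ : ℝ := ε / (E * W + 1) with hδ
  have hδ0 : 0 < δ := by positivity
  obtain ⟨C, hC1, hC⟩ := tau_bound δ hδ0
  set A : ℝ := c * (c * 2 ^ m) ^ ((m + 1) ^ 2) with hA
  have hc1 : 1 ≤ c := Nat.one_le_iff_ne_zero.2 hc
  have hA0 : 0 < A := by positivity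
  set K : ℝ := C * ((1 + 1 / δ) * (2 * dd * C)) + C * (2 * C ^ m) with hK
  have hK0 : 0 < K := by positivity
  refine ⟨2 ^ m * (K ^ m * (A ^ δ) ^ W), by positivity, fun V hV F hF hdd S hS => ?_⟩
  set X : ℕ := c * (2 * V) ^ m with hX
  set Y : ℕ := c * X ^ ((m + 1) ^ 2) with hY
  have hX1 : 1 ≤ X := Nat.mul_pos hc1 (Nat.pow_pos (by omega))
  have hpowY : ∀ k ≤ (m + 1) ^ 2, X ^ k ≤ Y := fun k hk =>
    (Nat.pow_le_pow_right hX1 hk).trans (Nat.le_mul_of_pos_left _ hc1)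
  have hY1 : 1 ≤ Y := by simpa using hpowY 0 (by positivity)
  set Z : ℝ := (Y : ℝ) ^ δ with hZ
  have hY1' : (1 : ℝ) ≤ Y := by exact_mod_cast hY1
  have hV' : (1 : ℝ) ≤ V := by exact_mod_cast hV
  have hX1' : (1 : ℝ) ≤ X := by exact_mod_cast hX1
  have hZ1 : 1 ≤ Z := Real.one_le_rpow hY1' hδ0.le
  have hXY : X ≤ Y := by simpa using hpowY 1 (by nlinarith)
  set G := (Finset.Icc (-(V : ℤ)) V).filter
      (fun x => F x ≠ 0 ∧ (F x).natAbs ≤ c * (2 * V) ^ m) with hG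
  have hT1 : 1 ≤ C * Z := by nlinarith
  have hBp : ∀ p ⊆ G, p.card ≤ m → ∑ x ∈ G, psi F c m V p x ≤ K * Z ^ (m + 3) := by
    intro p hp hpm
    have h := psi_sum F hF c m V X dd Y hc G (Finset.filter_subset _ _)
      (fun x hx => (Finset.mem_filter.1 hx).2.1) (fun x hx => (Finset.mem_filter.1 hx).2.2) hX1
      (fun n => (Finset.card_le_card (Finset.filter_subset_filter _ (Finset.filter_subset _ _))).trans (hdd n))
      (C * Z) hT1 (fun n hn hnY => (hC n hn).trans (by
        have : (n : ℝ) ≤ Y := by exact_mod_cast hnY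
        rw [hZ]
        gcongr)) hXY (hpowY m (by nlinarith)) (by
        rw [← pow_succ, ← pow_mul]
        exact Nat.mul_le_mul_left _ (Nat.pow_le_pow_right hX1 (by nlinarith))) p hp hpm
    refine h.trans ?_
    have hlog : 1 + Real.log X ≤ (1 + 1 / δ) * Z := by
      have h1 : Real.log X ≤ Real.log Y := Real.log_le_log (by linarith) (by exact_mod_cast hXY)
      have h2 := Real.log_le_rpow_div (by linarith : (0 : ℝ) ≤ Y) hδ0
      have : (Y : ℝ) ^ δ / δ = 1 / δ * Z := by rw [hZ]; ring
      nlinarith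
    calc _ ≤ C * Z * (((1 + 1 / δ) * Z) * (2 * dd * (C * Z))) + C * Z * (2 * (C * Z) ^ m) := by
          gcongr
      _ = C * ((1 + 1 / δ) * (2 * dd * C)) * Z ^ 3 + C * (2 * C ^ m) * Z ^ (m + 1) := by
          rw [mul_pow]; ring
      _ ≤ C * ((1 + 1 / δ) * (2 * dd * C)) * Z ^ (m + 3) + C * (2 * C ^ m) * Z ^ (m + 3) := by
          gcongr <;> first | exact hZ1 | omega
      _ = _ := by rw [hK]; ring
  have hfin := both F c m V hc hV (K * Z ^ (m + 3)) (by positivity) hBp S hS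
  have hsq : Real.sqrt ((1 / (4 * (V : ℝ))) ^ m) = (2 ^ m * (V : ℝ) ^ ((m : ℝ) / 2))⁻¹ := by
    rw [Real.sqrt_eq_iff_mul_self_eq (by positivity) (by positivity)]
    rw [← mul_inv, one_div, inv_pow]
    congr 1
    have : (V : ℝ) ^ ((m : ℝ) / 2) * (V : ℝ) ^ ((m : ℝ) / 2) = (V : ℝ) ^ m := by
      rw [← Real.rpow_add (by linarith), add_halves, Real.rpow_natCast]
    rw [mul_mul_mul_comm, this, ← mul_pow, ← mul_pow]; norm_num
  rw [hsq, ← div_eq_mul_inv, div_le_iff₀ (by positivity)] at hfin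
  refine hfin.trans ?_
  have hYA : (Y : ℝ) = A * (V : ℝ) ^ E := by
    rw [hY, hX, hA, hE]; push_cast; ring
  have hZ' : Z = A ^ δ * (V : ℝ) ^ (E * δ) := by
    rw [hZ, hYA, Real.mul_rpow hA0.le (by positivity), ← Real.rpow_natCast, ← Real.rpow_mul (by positivity)]
  have hZW : Z ^ W ≤ (A ^ δ) ^ W * (V : ℝ) ^ ε := by
    rw [hZ', mul_pow]
    gcongr
    rw [← Real.rpow_natCast, ← Real.rpow_mul (by positivity)]
    apply Real.rpow_le_rpow_of_exponent_le hV'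
    rw [hδ]
    have : (E : ℝ) * (ε / (E * W + 1)) * W = ε * ((E * W) / (E * W + 1)) := by ring
    rw [this]
    have h2 : ((E : ℝ) * W) / (E * W + 1) ≤ 1 := by
      rw [div_le_one (by positivity)]; linarith
    nlinarith
  have : (K * Z ^ (m + 3)) ^ m = K ^ m * Z ^ W := by
    rw [mul_pow, ← pow_mul, hW, mul_comm m (m + 3)]
  rw [this, Real.rpow_add (by linarith)]
  calc _ ≤ K ^ m * ((A ^ δ) ^ W * (V : ℝ) ^ ε) * (2 ^ m * (V : ℝ) ^ ((m : ℝ) / 2)) := by gcongr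
    _ = _ := by ring

open Polynomial in
/-- weighted coefficient bound -/
def Bd (V A : ℝ) (p : ℤ[X]) : Prop := ∀ e, |(p.coeff e : ℝ)| * V ^ e ≤ A

open Polynomial in
theorem Bd.add_add {V A B : ℝ} (hV : 0 ≤ V) {p q : ℤ[X]} (hp : Bd V A p) (hq : Bd V B q) :
    Bd V (A + B) (p + q) := by
  intro e
  rw [coeff_add]
  push_cast
  have h1 := hp e
  have h2 := hq e
  have h3 := abs_add_le (p.coeff e : ℝ) (q.coeff e)
  have h4 : 0 ≤ V ^ e := by positivity
  nlinarith

open Polynomial in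
theorem Bd.mono {V A B : ℝ} {p : ℤ[X]} (hp : Bd V A p) (h : A ≤ B) : Bd V B p :=
  fun e => (hp e).trans h

open Polynomial in
theorem Bd.C_mul {V A : ℝ} {p : ℤ[X]} (hp : Bd V A p) (c : ℤ) :
    Bd V (|(c : ℝ)| * A) (C c * p) := by
  intro e
  rw [coeff_C_mul]
  push_cast
  rw [abs_mul, mul_assoc]
  exact mul_le_mul_of_nonneg_left (hp e) (abs_nonneg _)

open Polynomial in
theorem Bd.sum {V : ℝ} (hV : 0 ≤ V) {ι : Type*} (s : Finset ι) (A : ι → ℝ) (p : ι → ℤ[X])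
    (h : ∀ i ∈ s, Bd V (A i) (p i)) : Bd V (∑ i ∈ s, A i) (∑ i ∈ s, p i) := by
  classical
  induction s using Finset.induction_on with
  | empty => intro e; simp
  | insert j s hj ih =>
    rw [Finset.sum_insert hj, Finset.sum_insert hj]
    exact (h j (Finset.mem_insert_self _ _)).add_add hV
      (ih fun i hi => h i (Finset.mem_insert_of_mem hi))

open Polynomial in
theorem Bd.mul_linear {V A : ℝ} (hV : 0 ≤ V) {p : ℤ[X]} (hp : Bd V A p) (a : ℤ)
    (ha : |(a : ℝ)| ≤ V) : Bd V (2 * V * A) ((X + C a) * p) := by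
  have hA : 0 ≤ A := le_trans (by positivity) (hp 0)
  intro e
  have h1 : |((a : ℤ) * p.coeff e : ℝ)| * V ^ e ≤ V * A := by
    rw [abs_mul, mul_assoc]
    exact mul_le_mul ha (hp e) (by positivity) hV
  rw [add_mul, coeff_add, coeff_C_mul]
  cases e with
  | zero =>
    simp only [mul_coeff_zero, coeff_X_zero, zero_mul, zero_add]
    push_cast
    nlinarith
  | succ e =>
    rw [coeff_X_mul]
    push_cast
    have h2 : |(p.coeff e : ℝ)| * V ^ (e + 1) ≤ V * A := by
      have := hp e
      rw [pow_succ, ← mul_assoc, mul_comm]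
      gcongr
    have h3 := abs_add_le (p.coeff e : ℝ) (a * p.coeff (e + 1))
    have h4 : 0 ≤ V ^ (e + 1) := by positivity
    nlinarith

open Polynomial in
theorem Bd.prod {V : ℝ} (hV : 0 ≤ V) {ι : Type*} (s : Finset ι) (v : ι → ℤ)
    (h : ∀ i ∈ s, |(v i : ℝ)| ≤ V) : Bd V ((2 * V) ^ s.card) (∏ i ∈ s, (X + C (v i))) := by
  classical
  induction s using Finset.induction_on with
  | empty =>
    intro e
    rw [Finset.prod_empty, coeff_one]
    split_ifs with he
    · subst he; simp
    · simp
  | insert j s hj ih =>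
    rw [Finset.prod_insert hj, Finset.card_insert_of_notMem hj, pow_succ']
    exact (ih fun i hi => h i (Finset.mem_insert_of_mem hi)).mul_linear hV _
      (h j (Finset.mem_insert_self _ _))

open Polynomial in
theorem Bd.prod_sub {V δ : ℝ} (hV : 0 ≤ V) {ι : Type*} (s : Finset ι) (v w : ι → ℤ)
    (h : ∀ i ∈ s, |(v i : ℝ)| ≤ V) (h' : ∀ i ∈ s, |(w i : ℝ)| ≤ V)
    (hd : ∀ i ∈ s, |(v i - w i : ℝ)| ≤ 2 * V * δ) :
    Bd V (s.card * δ * (2 * V) ^ s.card) (∏ i ∈ s, (X + C (v i)) - ∏ i ∈ s, (X + C (w i))) := by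
  classical
  induction s using Finset.induction_on with
  | empty => intro e; simp
  | insert j s hj ih =>
    rw [Finset.prod_insert hj, Finset.prod_insert hj, Finset.card_insert_of_notMem hj]
    have e1 : (X + C (v j)) * ∏ i ∈ s, (X + C (v i)) - (X + C (w j)) * ∏ i ∈ s, (X + C (w i)) =
      (X + C (v j)) * (∏ i ∈ s, (X + C (v i)) - ∏ i ∈ s, (X + C (w i))) +
        C (v j - w j) * ∏ i ∈ s, (X + C (w i)) := by
      rw [C_sub]; ring
    rw [e1]
    have h1 := (ih (fun i hi => h i (Finset.mem_insert_of_mem hi))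
      (fun i hi => h' i (Finset.mem_insert_of_mem hi))
      (fun i hi => hd i (Finset.mem_insert_of_mem hi))).mul_linear hV (v j)
      (h j (Finset.mem_insert_self _ _))
    have h2 := (Bd.prod hV s w (fun i hi => h' i (Finset.mem_insert_of_mem hi))).C_mul (v j - w j)
    refine (h1.add_add hV h2).mono ?_
    have h3 := hd j (Finset.mem_insert_self _ _)
    push_cast
    have h4 : 0 ≤ (2 * V) ^ s.card := by positivity
    have := mul_le_mul_of_nonneg_right h3 h4
    rw [pow_succ]
    nlinarith

open Polynomial in
/-- cleared denominators -/
noncomputable def PP {m : ℕ} (c v : Fin m → ℤ) : ℤ[X] :=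
  ∑ i, C (c i) * ∏ j ∈ Finset.univ.erase i, (X + C (v j))

open Polynomial in
theorem PP_eval_neg {m : ℕ} (c v : Fin m → ℤ) (i : Fin m) :
    (PP c v).eval (-v i) = c i * ∏ j ∈ Finset.univ.erase i, (v j - v i) := by
  unfold PP
  rw [eval_finsetSum, Finset.sum_eq_single i]
  · rw [eval_mul, eval_C, eval_prod]
    congr 1
    refine Finset.prod_congr rfl fun j _ => ?_
    simp; ring
  · intro j _ hj
    rw [eval_mul, eval_prod, Finset.prod_eq_zero (i := i)]
    · simp
    · simp [hj.symm]
    · simp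
  · simp

open Polynomial in
theorem PP_ne_zero {m : ℕ} (hm : 0 < m) (c v : Fin m → ℤ) (hc : ∀ i, c i ≠ 0)
    (hv : Function.Injective v) : PP c v ≠ 0 := by
  intro h
  have := PP_eval_neg c v ⟨0, hm⟩
  rw [h, eval_zero] at this
  refine mul_ne_zero (hc _) ?_ this.symm
  rw [Finset.prod_ne_zero_iff]
  intro j hj h'
  exact (Finset.ne_of_mem_erase hj) (hv (sub_eq_zero.1 h'))

open Polynomial in
theorem PP_natDegree {m : ℕ} (hm : 2 ≤ m) (c v : Fin m → ℤ) (hsum : ∑ i, c i = 0) :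
    (PP c v).natDegree + 2 ≤ m := by
  have hmon : ∀ i : Fin m, (∏ j ∈ Finset.univ.erase i, (X + C (v j))).Monic := fun i =>
    monic_prod_of_monic _ _ fun j _ => monic_X_add_C _
  have hdeg : ∀ i : Fin m, (∏ j ∈ Finset.univ.erase i, (X + C (v j))).natDegree = m - 1 := by
    intro i
    rw [natDegree_prod_of_monic _ _ fun j _ => monic_X_add_C _]
    simp only [natDegree_X_add_C]
    simp
  have h1 : (PP c v).natDegree ≤ m - 1 := by
    unfold PP
    apply natDegree_sum_le_of_forall_le
    intro i _
    exact (natDegree_C_mul_le _ _).trans (hdeg i).le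
  have h2 : (PP c v).coeff (m - 1) = 0 := by
    unfold PP
    rw [finsetSum_coeff, ← hsum]
    refine Finset.sum_congr rfl fun i _ => ?_
    have := (hmon i).coeff_natDegree
    rw [hdeg i] at this
    rw [coeff_C_mul, this, mul_one]
  by_contra hcon
  have h3 : (PP c v).natDegree = m - 1 := by omega
  rw [← h3, coeff_natDegree, leadingCoeff_eq_zero] at h2
  rw [h2] at h3
  simp at h3
  omega

open Polynomial in
theorem PP_Bd {m : ℕ} (V : ℝ) (hV : 0 ≤ V) (c v : Fin m → ℤ) (hv : ∀ i, |(v i : ℝ)| ≤ V) :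
    Bd V ((∑ i, |(c i : ℝ)|) * (2 * V) ^ (m - 1)) (PP c v) := by
  rw [Finset.sum_mul]
  refine Bd.sum hV _ _ _ fun i _ => Bd.C_mul ?_ _
  have := Bd.prod hV (Finset.univ.erase i) v fun i _ => hv i
  simpa using this

open Polynomial in
theorem PP_Bd_sub {m : ℕ} (V δ : ℝ) (hV : 0 ≤ V) (hδ : 0 ≤ δ) (c v w : Fin m → ℤ)
    (hv : ∀ i, |(v i : ℝ)| ≤ V) (hw : ∀ i, |(w i : ℝ)| ≤ V)
    (hd : ∀ i, |(v i - w i : ℝ)| ≤ 2 * V * δ) :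
    Bd V (m * δ * ((∑ i, |(c i : ℝ)|) * (2 * V) ^ (m - 1))) (PP c v - PP c w) := by
  unfold PP
  rw [← Finset.sum_sub_distrib, Finset.sum_mul, Finset.mul_sum]
  refine Bd.sum hV _ _ _ fun i _ => ?_
  rw [← mul_sub]
  have := (Bd.prod_sub hV (Finset.univ.erase i) v w (fun i _ => hv i) (fun i _ => hw i)
    (fun i _ => hd i)).C_mul (c i)
  refine this.mono ?_
  have hcard : (Finset.univ.erase i).card = m - 1 := by simp
  rw [hcard]
  have : ((m - 1 : ℕ) : ℝ) ≤ m := by exact_mod_cast Nat.sub_le _ _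
  have h2 : 0 ≤ |(c i : ℝ)| * (δ * (2 * V) ^ (m - 1)) := by positivity
  nlinarith

open Polynomial in
theorem PP_root {m : ℕ} (q : ℕ) (lam : ℤ) (c v : Fin m → ℤ)
    (hu : ∀ i, IsUnit ((lam + v i : ℤ) : ZMod q))
    (h : ∑ i, (c i : ZMod q) * ((lam + v i : ℤ) : ZMod q)⁻¹ = 0) :
    (q : ℤ) ∣ (PP c v).eval lam := by
  rw [← ZMod.intCast_zmod_eq_zero_iff_dvd]
  unfold PP
  rw [eval_finsetSum]
  push_cast
  have : (∏ j, ((lam + v j : ℤ) : ZMod q)) * ∑ i, (c i : ZMod q) * ((lam + v i : ℤ) : ZMod q)⁻¹ = 0 := by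
    rw [h, mul_zero]
  rw [← this, Finset.mul_sum]
  refine Finset.sum_congr rfl fun i _ => ?_
  rw [eval_mul, eval_C, eval_prod]
  push_cast
  rw [← Finset.mul_prod_erase Finset.univ _ (Finset.mem_univ i)]
  have hinv : ((lam + v i : ℤ) : ZMod q) * ((lam + v i : ℤ) : ZMod q)⁻¹ = 1 :=
    ZMod.mul_inv_of_unit _ (hu i)
  push_cast at hinv
  simp only [eval_add, eval_X, eval_C, Int.cast_add]
  linear_combination (-(c i : ZMod q) * ∏ j ∈ Finset.univ.erase i, ((lam : ZMod q) + v j)) * hinv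

open Polynomial in
theorem resultant_bound (V A A' : ℝ) (hV : 1 ≤ V) (d : ℕ) (f g : ℤ[X]) (hf : Bd V A f)
    (hg : Bd V A' g) :
    |((resultant f g d d : ℤ) : ℝ)| * V ^ (d ^ 2) ≤ (d + d).factorial * (A ^ d * A' ^ d) := by
  have hA : 0 ≤ A := le_trans (by positivity) (hf 0)
  have hA' : 0 ≤ A' := le_trans (by positivity) (hg 0)
  set s : ℕ := ∑ i : Fin d, (i : ℕ) with hs
  have hs2 : ∑ i : Fin (d + d), (i : ℕ) = s + (d ^ 2 + s) := by
    rw [Fin.sum_univ_add]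
    simp [Finset.sum_add_distrib, hs, sq]
    ring
  have hcol : ∀ σ : Equiv.Perm (Fin (d + d)),
      |((∏ i, sylvester f g d d (σ i) i : ℤ) : ℝ)| * V ^ (s + (d ^ 2 + s)) ≤
        A ^ d * A' ^ d * V ^ (s + s) := by
    intro σ
    have e1 : V ^ (s + (d ^ 2 + s)) = ∏ i, V ^ ((σ i : Fin (d + d)) : ℕ) := by
      rw [← hs2, ← Equiv.sum_comp σ, Finset.prod_pow_eq_pow_sum]
    have e2 : A ^ d * A' ^ d * V ^ (s + s) =
        ∏ i : Fin (d + d), (i.addCases (fun j => A' * V ^ (j : ℕ)) (fun j => A * V ^ (j : ℕ)) : ℝ) := by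
      rw [Fin.prod_univ_add]
      simp only [Fin.addCases_left, Fin.addCases_right, Finset.prod_mul_distrib,
        Finset.prod_pow_eq_pow_sum, Finset.prod_const, Finset.card_univ, Fintype.card_fin, ← hs]
      ring
    rw [e1, e2, Int.cast_prod, Finset.abs_prod, ← Finset.prod_mul_distrib]
    refine Finset.prod_le_prod (fun _ _ => by positivity) fun i _ => ?_
    generalize σ i = k
    have gen : ∀ (p : ℤ[X]) (B : ℝ) (hp : Bd V B p) (j : ℕ),
        |(((if (k : ℕ) ∈ Set.Icc j (j + d) then p.coeff (k - j) else 0 : ℤ)) : ℝ)| * V ^ (k : ℕ)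
          ≤ B * V ^ j := by
      intro p B hp j
      have hB : 0 ≤ B := le_trans (by positivity) (hp 0)
      split_ifs with h
      · have := hp (k - j)
        have e : V ^ (k : ℕ) = V ^ ((k : ℕ) - j) * V ^ j := by
          rw [← pow_add, Nat.sub_add_cancel h.1]
        rw [e, ← mul_assoc]
        gcongr
      · simp; positivity
    induction i using Fin.addCases with
    | left j =>
      simp only [sylvester, Matrix.of_apply, Fin.addCases_left]
      exact gen g A' hg j
    | right j =>
      simp only [sylvester, Matrix.of_apply, Fin.addCases_right]
      exact gen f A hf j
  have hdet : |((resultant f g d d : ℤ) : ℝ)| * V ^ (s + (d ^ 2 + s)) ≤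
      (d + d).factorial * (A ^ d * A' ^ d * V ^ (s + s)) := by
    rw [resultant, Matrix.det_apply, Int.cast_sum]
    calc _ ≤ (∑ σ : Equiv.Perm (Fin (d + d)),
          |((Equiv.Perm.sign σ • ∏ i, sylvester f g d d (σ i) i : ℤ) : ℝ)|) * V ^ (s + (d ^ 2 + s)) := by
          gcongr
          exact Finset.abs_sum_le_sum_abs _ _
      _ = ∑ σ : Equiv.Perm (Fin (d + d)),
          |((∏ i, sylvester f g d d (σ i) i : ℤ) : ℝ)| * V ^ (s + (d ^ 2 + s)) := by
          rw [Finset.sum_mul]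
          refine Finset.sum_congr rfl fun σ _ => ?_
          congr 1
          rcases Int.units_eq_one_or (Equiv.Perm.sign σ) with h | h <;> rw [h] <;> simp
      _ ≤ ∑ σ : Equiv.Perm (Fin (d + d)), A ^ d * A' ^ d * V ^ (s + s) :=
          Finset.sum_le_sum fun σ _ => hcol σ
      _ = _ := by
          rw [Finset.sum_const, nsmul_eq_mul, Finset.card_univ, Fintype.card_perm, Fintype.card_fin]
  have hVs : 0 < V ^ (s + s) := by positivity
  have e3 : V ^ (s + (d ^ 2 + s)) = V ^ (d ^ 2) * V ^ (s + s) := by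
    rw [← pow_add]; congr 1; ring
  rw [e3, ← mul_assoc, ← mul_assoc] at hdet
  exact le_of_mul_le_mul_right hdet hVs

open Polynomial in
theorem alg_lemma (α : ℂ) (P0 : ℤ[X]) (h0 : P0 ≠ 0) (hr : aeval α P0 = 0) :
    ∃ f : ℤ[X], 0 < f.natDegree ∧ ∀ P : ℤ[X], aeval α P = 0 → f ∣ P := by
  have hP0 : P0.map (Int.castRingHom ℚ) ≠ 0 := by
    rwa [Ne, Polynomial.map_eq_zero_iff (Int.cast_injective : Function.Injective (Int.castRingHom ℚ))]
  have hinjQ : Function.Injective (Int.castRingHom ℚ) := Int.cast_injective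
  have hmap : ∀ P : ℤ[X], aeval α P = 0 → aeval α (P.map (Int.castRingHom ℚ)) = 0 := by
    intro P hP
    have := aeval_map_algebraMap (A := ℚ) α P
    rw [← hP, ← this]
    rfl
  have hintegral : IsIntegral ℚ α :=
    IsAlgebraic.isIntegral ⟨_, hP0, hmap _ hr⟩
  set g := minpoly ℚ α with hg
  have hgpos : 0 < g.natDegree := minpoly.natDegree_pos hintegral
  obtain ⟨b, hbM, hb⟩ := IsLocalization.integerNormalization_spec (nonZeroDivisors ℤ) g
  set N := IsLocalization.integerNormalization (nonZeroDivisors ℤ) g with hN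
  have hb0 : (b : ℤ) ≠ 0 := nonZeroDivisors.ne_zero hbM
  have hN2 : N.map (Int.castRingHom ℚ) = C ((b : ℤ) : ℚ) * g := by
    change N.map (algebraMap ℤ ℚ) = _
    rw [hb]
    ext n
    simp
  have hb0' : ((b : ℤ) : ℚ) ≠ 0 := by exact_mod_cast hb0
  refine ⟨N.primPart, ?_, ?_⟩
  · rw [natDegree_primPart, ← natDegree_map_eq_of_injective hinjQ,
      hN2, natDegree_C_mul hb0']
    exact hgpos
  · intro P hP
    rw [IsPrimitive.Int.dvd_iff_map_cast_dvd_map_cast _ _ (isPrimitive_primPart N)]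
    refine dvd_trans ?_ (minpoly.dvd ℚ α (hmap P hP))
    have h1 : N.primPart.map (Int.castRingHom ℚ) ∣ C ((b : ℤ) : ℚ) * g := by
      rw [← hN2]
      exact Polynomial.map_dvd _ (primPart_dvd N)
    exact (IsUnit.dvd_mul_left (isUnit_C.2 (isUnit_iff_ne_zero.2 hb0'))).1 h1

open Polynomial in
theorem common_root (q : ℕ) (lam : ℤ) (d : ℕ) (hd : 1 ≤ d) (P Q : ℤ[X])
    (hP : P.natDegree = d) (hQ : Q.natDegree = d) (hPl : (q : ℤ) ∣ P.eval lam)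
    (hQl : (q : ℤ) ∣ Q.eval lam) (hlt : |((resultant P (Q - P) d d : ℤ) : ℝ)| < q) :
    ∃ α : ℂ, aeval α P = 0 ∧ aeval α Q = 0 := by
  have hP0 : P ≠ 0 := by rintro rfl; simp at hP; omega
  have h1 : resultant P Q d d = resultant P (Q - P) d d := by
    rw [← resultant_add_mul_right P (Q - P) 1 d d (by simp) hP.le]
    congr 1; ring
  rw [← h1] at hlt
  have hdvd : (q : ℤ) ∣ resultant P Q d d := by
    obtain ⟨a, b, _, _, hab⟩ := exists_mul_add_mul_eq_C_resultant P Q hP.le hQ.le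
      (Or.inl (by omega : d ≠ 0))
    have := congrArg (eval lam) hab
    rw [eval_C] at this
    rw [← this, eval_add, eval_mul, eval_mul]
    exact dvd_add (hPl.mul_right _) (hQl.mul_right _)
  have hz : resultant P Q d d = 0 := by
    apply Int.eq_zero_of_abs_lt_dvd hdvd
    exact_mod_cast hlt
  have hinj : Function.Injective (Int.castRingHom ℂ) := Int.cast_injective
  have hz2 : resultant (P.map (Int.castRingHom ℂ)) (Q.map (Int.castRingHom ℂ)) = 0 := by
    rw [natDegree_map_eq_of_injective hinj, natDegree_map_eq_of_injective hinj, hP, hQ,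
      resultant_map_map, hz, map_zero]
  rw [resultant_eq_zero_iff] at hz2
  by_contra hcon
  push Not at hcon
  apply hz2.2
  rw [isCoprime_iff_aeval_ne_zero_of_isAlgClosed ℂ ℂ]
  intro a
  have e : ∀ R : ℤ[X], aeval a (R.map (Int.castRingHom ℂ)) = aeval a R := fun R => aeval_map_algebraMap (A := ℂ) a R
  rw [e, e]
  by_cases h : aeval a P = 0
  · exact Or.inr (hcon a h)
  · exact Or.inl h

theorem card_le_fibers {α β : Type*} [DecidableEq β] (S : Finset α) (T : Finset β) (k : α → β)
    (hk : ∀ x ∈ S, k x ∈ T) (B : ℝ)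
    (h : ∀ t ∈ T, ((S.filter (fun x => k x = t)).card : ℝ) ≤ B) : (S.card : ℝ) ≤ T.card * B := by
  rw [Finset.card_eq_sum_card_fiberwise hk]
  push_cast
  calc _ ≤ ∑ t ∈ T, B := Finset.sum_le_sum h
    _ = _ := by rw [Finset.sum_const, nsmul_eq_mul]

open Polynomial in
theorem class_bound (m : ℕ) (c : Fin m → ℤ) (hc : ∀ i, c i ≠ 0) (ε : ℝ) (hε : 0 < ε) :
    ∃ K : ℝ, 0 < K ∧ ∀ V : ℕ, 1 ≤ V → ∀ P0 : ℤ[X], P0 ≠ 0 → P0.natDegree ≤ m →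
      ∀ S : Finset (Fin m → ℤ), (∀ v ∈ S, (∀ i, v i ∈ Finset.Icc (-(V : ℤ)) V) ∧
        Function.Injective v ∧ ∃ α : ℂ, aeval α P0 = 0 ∧ aeval α (PP c v) = 0) →
      (S.card : ℝ) ≤ K * (V : ℝ) ^ ((m : ℝ) / 2 + ε) := by
  classical
  have hc' : (∏ i, (c i).natAbs) ≠ 0 := by
    rw [Finset.prod_ne_zero_iff]
    intro i _
    simpa using hc i
  obtain ⟨K0, hK0, hcore⟩ := count_core m m (∏ i, (c i).natAbs) hc' ε hε
  refine ⟨(m + 1) * K0, by positivity, ?_⟩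
  intro V hV P0 hP0 hdeg S hS
  have hpow : 0 ≤ (V : ℝ) ^ ((m : ℝ) / 2 + ε) := by positivity
  choose! α hα using fun v (hv : v ∈ S) => (hS v hv).2.2
  have hT : ∀ v ∈ S, α v ∈ (P0.aroots ℂ).toFinset := by
    intro v hv
    rw [Multiset.mem_toFinset, mem_aroots]
    exact ⟨hP0, (hα v hv).1⟩
  have hcard : ((P0.aroots ℂ).toFinset.card : ℝ) ≤ m + 1 := by
    have h1 : (P0.aroots ℂ).toFinset.card ≤ m :=
      (Multiset.toFinset_card_le _).trans ((card_roots' _).trans (natDegree_map_le.trans hdeg))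
    have : ((P0.aroots ℂ).toFinset.card : ℝ) ≤ m := by exact_mod_cast h1
    linarith
  have hfib : ∀ t ∈ (P0.aroots ℂ).toFinset,
      ((S.filter (fun v => α v = t)).card : ℝ) ≤ K0 * (V : ℝ) ^ ((m : ℝ) / 2 + ε) := by
    intro t ht
    rw [Multiset.mem_toFinset, mem_aroots] at ht
    obtain ⟨f, hfpos, hf⟩ := alg_lemma t P0 hP0 ht.2
    have hfdeg : f.natDegree ≤ m := (natDegree_le_of_dvd (hf P0 ht.2) hP0).trans hdeg
    apply hcore V hV (fun x => f.eval (-x))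
    · intro a b
      have h1 := sub_dvd_eval_sub (-a) (-b) f
      have h2 : -a - -b = -(a - b) := by ring
      rwa [h2, neg_dvd] at h1
    · intro n
      have hne : f - C n ≠ 0 := by
        intro h
        rw [sub_eq_zero.1 h, natDegree_C] at hfpos
        omega
      have hle : ((Finset.Icc (-(V : ℤ)) V).filter (fun x => f.eval (-x) = n)).card ≤
          (f - C n).roots.toFinset.card := by
        apply Finset.card_le_card_of_injOn (fun x => -x)
        · intro x hx
          simp only [Finset.coe_filter, Set.mem_ofPred_eq] at hx
          simp only [Finset.mem_coe, Multiset.mem_toFinset, mem_roots hne, IsRoot, eval_sub, eval_C, hx.2,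
            sub_self]
        · intro x _ y _ hxy
          exact neg_injective hxy
      refine hle.trans ((Multiset.toFinset_card_le _).trans ((card_roots' _).trans ?_))
      rw [natDegree_sub_C]
      exact hfdeg
    · intro v hv
      rw [Finset.mem_filter] at hv
      obtain ⟨h1, h2, _⟩ := hS v hv.1
      refine ⟨h1, h2, fun i => ?_⟩
      have h3 := hf (PP c v) (hv.2 ▸ (hα v hv.1).2)
      have h4 : f.eval (-v i) ∣ (PP c v).eval (-v i) := eval_dvd h3
      rw [PP_eval_neg] at h4
      refine h4.trans (mul_dvd_mul_right ?_ _)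
      have h5 : (c i).natAbs ∣ ∏ i, (c i).natAbs := Finset.dvd_prod_of_mem _ (Finset.mem_univ i)
      exact Int.natAbs_dvd.1 (Int.natCast_dvd_natCast.2 h5)
  refine (card_le_fibers S _ α hT _ hfib).trans ?_
  rw [mul_assoc]
  exact mul_le_mul_of_nonneg_right hcard (by positivity)

theorem exp_check (r m d : ℕ) (hm : m ≤ 2 * r) (hd : d + 2 ≤ m) :
    2 * d * (m - 1) ≤ 4 * r * (r - 1) + d ^ 2 := by
  obtain ⟨s, rfl⟩ : ∃ s, r = s + 1 := ⟨r - 1, by omega⟩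
  obtain ⟨k, rfl⟩ : ∃ k, m = d + 2 + k := ⟨m - d - 2, by omega⟩
  have e1 : d + 2 + k - 1 = d + 1 + k := by omega
  have e2 : s + 1 - 1 = s := by omega
  rw [e1, e2]
  have h : d + k ≤ 2 * s := by omega
  have h3 : (d + k) * (d + k + 2) ≤ 2 * s * (2 * s + 2) := Nat.mul_le_mul h (by omega)
  nlinarith

open Polynomial in
theorem lemmaA (r m : ℕ) (hr : 2 ≤ r) (hm2 : 2 ≤ m) (hm : m ≤ 2 * r) (c : Fin m → ℤ)
    (hc : ∀ i, c i ≠ 0) (hsum : ∑ i, c i = 0) (ε : ℝ) (hε : 0 < ε) :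
    ∃ K : ℝ, 0 < K ∧ ∀ q : ℕ, 0 < q → ∀ lam : ℤ, ∀ V : ℕ, 1 ≤ V → V ^ (4 * r * (r - 1)) ≤ q →
      ∀ S : Finset (Fin m → ℤ), (∀ v ∈ S, (∀ i, v i ∈ Finset.Icc (-(V : ℤ)) V) ∧
        Function.Injective v ∧ (∀ i, IsUnit ((lam + v i : ℤ) : ZMod q)) ∧
        ∑ i, (c i : ZMod q) * ((lam + v i : ℤ) : ZMod q)⁻¹ = 0) →
      (S.card : ℝ) ≤ K * (V : ℝ) ^ ((m : ℝ) / 2 + ε) := by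
  classical
  obtain ⟨K1, hK1, hclass⟩ := class_bound m c hc ε hε
  set a : ℝ := (∑ i, |(c i : ℝ)|) * 2 ^ (m - 1) with ha
  have ha0 : 0 ≤ a := by positivity
  obtain ⟨L, hL⟩ := exists_nat_gt ((2 * m).factorial * (a ^ 2 * m) + 1)
  have hfac1 : (1 : ℝ) ≤ (2 * m).factorial := by exact_mod_cast Nat.one_le_iff_ne_zero.2 (Nat.factorial_ne_zero _)
  have hL1 : (1 : ℝ) < L := lt_of_le_of_lt (by linarith [show (0:ℝ) ≤ (2 * m).factorial * (a ^ 2 * m) by positivity]) hL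
  have hL0 : 0 < L := by
    have : (0 : ℝ) < L := by linarith
    exact_mod_cast this
  refine ⟨(2 * a + 1) ^ m + ((2 * L + 1) ^ m * (m + 1)) * K1, by positivity, ?_⟩
  intro q hq lam V hV hVq S hS
  have hV1 : (1 : ℝ) ≤ V := by exact_mod_cast hV
  have hpow1 : 1 ≤ (V : ℝ) ^ ((m : ℝ) / 2 + ε) := Real.one_le_rpow hV1 (by positivity)
  have habs : ∀ v ∈ S, ∀ i, |(v i : ℝ)| ≤ V := by
    intro v hv i
    have := Finset.mem_Icc.1 ((hS v hv).1 i)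
    rw [abs_le]
    exact ⟨by exact_mod_cast this.1, by exact_mod_cast this.2⟩
  by_cases hVa : (V : ℝ) ≤ a
  · -- trivial bound
    have h1 : S.card ≤ (2 * V + 1) ^ m := by
      have : S ⊆ Fintype.piFinset (fun _ : Fin m => Finset.Icc (-(V : ℤ)) V) := by
        intro v hv
        rw [Fintype.mem_piFinset]
        exact (hS v hv).1
      refine (Finset.card_le_card this).trans ?_
      rw [Fintype.card_piFinset]
      simp only [Int.card_Icc, Finset.prod_const, Finset.card_univ, Fintype.card_fin]
      apply Nat.pow_le_pow_left
      omega
    have h2 : (S.card : ℝ) ≤ (2 * V + 1) ^ m := by exact_mod_cast h1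
    have h3 : (2 * (V : ℝ) + 1) ^ m ≤ (2 * a + 1) ^ m := by gcongr
    have h4 : 0 ≤ ((2 * L + 1) ^ m * (m + 1)) * K1 := by positivity
    have h5 : 0 ≤ (2 * a + 1) ^ m := by positivity
    nlinarith
  push Not at hVa
  -- degree zero does not occur
  have hBd : ∀ v ∈ S, Bd V (a * (V : ℝ) ^ (m - 1)) (PP c v) := by
    intro v hv
    have := PP_Bd (V : ℝ) (by positivity) c v (habs v hv)
    rwa [mul_pow, ← mul_assoc] at this
  have hroot : ∀ v ∈ S, (q : ℤ) ∣ (PP c v).eval lam := fun v hv =>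
    PP_root q lam c v (hS v hv).2.2.1 (hS v hv).2.2.2
  have hne : ∀ v ∈ S, PP c v ≠ 0 := fun v hv => PP_ne_zero (by omega) c v hc (hS v hv).2.1
  have hVqR : (V : ℝ) ^ (4 * r * (r - 1)) ≤ q := by exact_mod_cast hVq
  have hdpos : ∀ v ∈ S, 1 ≤ (PP c v).natDegree := by
    intro v hv
    by_contra hcon
    have h0 : (PP c v).natDegree = 0 := by omega
    obtain ⟨k, hk⟩ := natDegree_eq_zero.1 h0
    have h1 := hroot v hv
    rw [← hk, eval_C] at h1
    have h2 := hBd v hv 0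
    rw [← hk, coeff_C_zero, pow_zero, mul_one] at h2
    have h3 : |(k : ℝ)| < q := by
      refine lt_of_lt_of_le ?_ hVqR
      have h4 : a * (V : ℝ) ^ (m - 1) < V * (V : ℝ) ^ (m - 1) := by gcongr
      rw [← pow_succ', Nat.sub_add_cancel (by omega)] at h4
      have h5 : (V : ℝ) ^ m ≤ (V : ℝ) ^ (4 * r * (r - 1)) := by
        apply pow_le_pow_right₀ hV1
        have : 1 ≤ r - 1 := by omega
        nlinarith
      linarith
    have h4 : k = 0 := by
      apply Int.eq_zero_of_abs_lt_dvd h1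
      exact_mod_cast h3
    apply hne v hv
    rw [← hk, h4, C_0]
  -- classification
  let key : (Fin m → ℤ) → (Fin m → ℤ) × ℕ := fun v => (fun i => v i * L / V, (PP c v).natDegree)
  let T : Finset ((Fin m → ℤ) × ℕ) :=
    (Fintype.piFinset (fun _ : Fin m => Finset.Icc (-(L : ℤ)) L)) ×ˢ Finset.range (m + 1)
  have hVz : (0 : ℤ) < V := by exact_mod_cast hV
  have hLz : (0 : ℤ) < L := by exact_mod_cast hL0
  have hkT : ∀ v ∈ S, key v ∈ T := by
    intro v hv
    simp only [key, T, Finset.mem_product, Fintype.mem_piFinset, Finset.mem_Icc, Finset.mem_range]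
    refine ⟨fun i => ?_, ?_⟩
    · have := Finset.mem_Icc.1 ((hS v hv).1 i)
      constructor
      · rw [Int.le_ediv_iff_mul_le hVz]
        nlinarith
      · apply Int.ediv_le_of_le_mul hVz
        nlinarith
    · have := PP_natDegree hm2 c v hsum
      omega
  have hTcard : (T.card : ℝ) = (2 * L + 1) ^ m * (m + 1) := by
    have : T.card = (2 * L + 1) ^ m * (m + 1) := by
      simp only [T, Finset.card_product, Fintype.card_piFinset, Int.card_Icc, Finset.prod_const,
        Finset.card_univ, Fintype.card_fin, Finset.card_range]
      congr 2
      omega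
    exact_mod_cast this
  have hfib : ∀ t ∈ T, ((S.filter (fun v => key v = t)).card : ℝ) ≤ K1 * (V : ℝ) ^ ((m : ℝ) / 2 + ε) := by
    intro t _
    rcases (S.filter (fun v => key v = t)).eq_empty_or_nonempty with h | ⟨w, hw⟩
    · rw [h]; simp; positivity
    rw [Finset.mem_filter] at hw
    obtain ⟨hwS, hwt⟩ := hw
    have hwd := PP_natDegree hm2 c w hsum
    refine hclass V hV (PP c w) (hne w hwS) (by omega) _ ?_
    intro v hv
    rw [Finset.mem_filter] at hv
    obtain ⟨hvS, hvt⟩ := hv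
    refine ⟨(hS v hvS).1, (hS v hvS).2.1, ?_⟩
    have hkey : key v = key w := hvt.trans hwt.symm
    have hk1 : ∀ i, v i * L / V = w i * L / V := fun i => congrFun (congrArg Prod.fst hkey) i
    have hk2 : (PP c v).natDegree = (PP c w).natDegree := congrArg Prod.snd hkey
    set d := (PP c w).natDegree with hd
    have hd1 : 1 ≤ d := hdpos w hwS
    have hclose : ∀ i, |((v i : ℝ) - w i)| ≤ 2 * V * (1 / (2 * L)) := by
      intro i
      have h1 : |(v i - w i) * L| < V := by
        have a1 := Int.ediv_mul_le (v i * L) hVz.ne'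
        have a2 := Int.lt_ediv_add_one_mul_self (v i * L) hVz
        have a3 := Int.ediv_mul_le (w i * L) hVz.ne'
        have a4 := Int.lt_ediv_add_one_mul_self (w i * L) hVz
        rw [hk1 i] at a1 a2
        rw [abs_lt]
        constructor <;> nlinarith
      have h2 : |((v i : ℝ) - w i)| * L < V := by
        have : (|(v i - w i) * L| : ℝ) < V := by exact_mod_cast h1
        rwa [abs_mul, Nat.abs_cast] at this
      have h3 : 2 * (V : ℝ) * (1 / (2 * L)) = V / L := by field_simp
      rw [h3, le_div_iff₀ (by linarith)]
      exact h2.le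
    have hsub := PP_Bd_sub (V : ℝ) (1 / (2 * L)) (by positivity) (by positivity) c v w (habs v hvS)
      (habs w hwS) hclose
    have hres := resultant_bound (V : ℝ) _ _ hV1 d (PP c w) (PP c v - PP c w) (hBd w hwS) hsub
    apply common_root q lam d hd1 (PP c w) (PP c v) rfl hk2 (hroot w hwS) (hroot v hvS)
    set x : ℝ := a ^ 2 * m * (1 / (2 * L)) with hx
    have hx0 : 0 ≤ x := by positivity
    have hx1 : (2 * m).factorial * x < 1 := by
      rw [hx, ← mul_assoc, mul_one_div, div_lt_one (by linarith)]
      linarith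
    have hx2 : x ≤ 1 := by nlinarith
    have hx3 : ((d + d).factorial : ℝ) * x ^ d < 1 := by
      have f1 : ((d + d).factorial : ℝ) ≤ (2 * m).factorial := by
        exact_mod_cast Nat.factorial_le (by omega)
      have f2 : x ^ d ≤ x := by
        calc x ^ d ≤ x ^ 1 := pow_le_pow_of_le_one hx0 hx2 hd1
          _ = x := pow_one x
      calc _ ≤ ((2 * m).factorial : ℝ) * x := by gcongr
        _ < 1 := hx1
    have e1 : ((d + d).factorial : ℝ) * ((a * (V : ℝ) ^ (m - 1)) ^ d *
        (m * (1 / (2 * L)) * ((∑ i, |(c i : ℝ)|) * (2 * V) ^ (m - 1))) ^ d) =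
        ((d + d).factorial : ℝ) * x ^ d * (V : ℝ) ^ (2 * d * (m - 1)) := by
      have : (∑ i, |(c i : ℝ)|) * (2 * (V : ℝ)) ^ (m - 1) = a * (V : ℝ) ^ (m - 1) := by
        rw [ha, mul_pow, mul_assoc]
      rw [this, ← mul_pow, mul_assoc ((d + d).factorial : ℝ) (x ^ d), show 2 * d * (m - 1) = ((m - 1) * 2) * d by ring, pow_mul, ← mul_pow, hx]
      congr 2
      rw [pow_mul]
      ring
    rw [e1] at hres
    have hVd : (0 : ℝ) < (V : ℝ) ^ (d ^ 2) := by positivity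
    refine lt_of_mul_lt_mul_right (lt_of_le_of_lt hres ?_) hVd.le
    calc ((d + d).factorial : ℝ) * x ^ d * (V : ℝ) ^ (2 * d * (m - 1))
        < 1 * (V : ℝ) ^ (2 * d * (m - 1)) := by gcongr
      _ ≤ (V : ℝ) ^ (4 * r * (r - 1) + d ^ 2) := by
          rw [one_mul]
          exact pow_le_pow_right₀ hV1 (exp_check r m d hm hwd)
      _ ≤ q * (V : ℝ) ^ (d ^ 2) := by
          rw [pow_add]
          gcongr
  refine (card_le_fibers S T key hkT _ hfib).trans ?_
  rw [hTcard, add_mul, mul_assoc _ K1]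
  have : 0 ≤ (2 * a + 1) ^ m * (V : ℝ) ^ ((m : ℝ) / 2 + ε) := by positivity
  linarith

theorem lemmaA' (r : ℕ) (hr : 2 ≤ r) {ι : Type*} [Fintype ι] (hm : Fintype.card ι ≤ 2 * r)
    (c : ι → ℤ) (hc : ∀ i, c i ≠ 0) (hsum : ∑ i, c i = 0) (ε : ℝ) (hε : 0 < ε) :
    ∃ K : ℝ, 0 < K ∧ ∀ q : ℕ, 0 < q → ∀ lam : ℤ, ∀ V : ℕ, 1 ≤ V → V ^ (4 * r * (r - 1)) ≤ q →
      ∀ S : Finset (ι → ℤ), (∀ v ∈ S, (∀ i, v i ∈ Finset.Icc (-(V : ℤ)) V) ∧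
        Function.Injective v ∧ (∀ i, IsUnit ((lam + v i : ℤ) : ZMod q)) ∧
        ∑ i, (c i : ZMod q) * ((lam + v i : ℤ) : ZMod q)⁻¹ = 0) →
      (S.card : ℝ) ≤ K * (V : ℝ) ^ ((Fintype.card ι : ℝ) / 2 + ε) := by
  classical
  set m := Fintype.card ι with hmdef
  let e : Fin m ≃ ι := (Fintype.equivFin ι).symm
  by_cases hm2 : 2 ≤ m
  · obtain ⟨K, hK, h⟩ := lemmaA r m hr hm2 hm (fun i => c (e i)) (fun i => hc _)
      (by rw [← hsum]; exact Equiv.sum_comp e c) ε hε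
    refine ⟨K, hK, ?_⟩
    intro q hq lam V hV hVq S hS
    have hinj : Function.Injective (fun (v : ι → ℤ) (i : Fin m) => v (e i)) := by
      intro v w hvw
      funext i
      have := congrFun hvw (e.symm i)
      simpa using this
    rw [← Finset.card_image_of_injective S hinj]
    apply h q hq lam V hV hVq
    intro w hw
    obtain ⟨v, hv, rfl⟩ := Finset.mem_image.1 hw
    obtain ⟨h1, h2, h3, h4⟩ := hS v hv
    refine ⟨fun i => h1 _, h2.comp e.injective, fun i => h3 _, ?_⟩
    rw [← h4]
    exact Equiv.sum_comp e (fun i => (c i : ZMod q) * ((lam + v i : ℤ) : ZMod q)⁻¹)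
  · have h0 : IsEmpty ι := by
      by_contra hne
      rw [not_isEmpty_iff] at hne
      have h1 : m = 1 := by
        have : 0 < m := Fintype.card_pos
        omega
      obtain ⟨x, hx⟩ := Fintype.card_eq_one_iff.1 h1
      apply hc x
      rw [← hsum]
      rw [Finset.sum_eq_single x]
      · intro b _ hb
        exact absurd (hx b) hb
      · simp
    refine ⟨1, one_pos, ?_⟩
    intro q hq lam V hV hVq S hS
    have hV1 : (1 : ℝ) ≤ V := by exact_mod_cast hV
    have hpow1 : 1 ≤ (V : ℝ) ^ ((m : ℝ) / 2 + ε) := Real.one_le_rpow hV1 (by positivity)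
    have : S.card ≤ 1 := Finset.card_le_one.2 fun a _ b _ => Subsingleton.elim a b
    have : (S.card : ℝ) ≤ 1 := by exact_mod_cast this
    linarith

theorem shape_card (n : ℕ) (s : Fin n → ℤ) (hs : ∀ i, s i ≠ 0) (κ : Fin n → Fin n)
    (c : Fin n → ℤ) (hc : ∀ j, c j = ∑ i ∈ Finset.univ.filter (fun i => κ i = j), s i) :
    Fintype.card {j // c j ≠ 0} + 2 * Fintype.card {j // κ j = j ∧ c j = 0} ≤ n := by
  classical
  have h1 : ∑ j : Fin n, (Finset.univ.filter (fun i => κ i = j)).card = n := by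
    rw [← Finset.card_eq_sum_card_fiberwise (fun i _ => Finset.mem_univ _)]
    simp
  rw [Fintype.card_subtype, Fintype.card_subtype, Finset.card_filter, Finset.card_filter,
    Finset.mul_sum, ← Finset.sum_add_distrib]
  refine le_trans (Finset.sum_le_sum fun j _ => ?_) h1.le
  by_cases hcj : c j = 0
  · simp only [hcj]
    by_cases hk : κ j = j
    · simp only [hk]
      simp only [ne_eq, not_true_eq_false, if_false, and_self, if_true]
      by_contra hcon
      have hj : j ∈ Finset.univ.filter (fun i => κ i = j) := by simp [hk]
      have hle : (Finset.univ.filter (fun i => κ i = j)).card ≤ 1 := by omega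
      have heq : Finset.univ.filter (fun i => κ i = j) = {j} := by
        apply Finset.eq_singleton_iff_unique_mem.2
        exact ⟨hj, fun x hx => Finset.card_le_one.1 hle x hx j hj⟩
      have := hc j
      rw [heq, Finset.sum_singleton, hcj] at this
      exact hs j this.symm
    · simp [hk]
  · rw [if_pos hcj, if_neg (fun h => hcj h.2)]
    rw [mul_zero, add_zero, Nat.one_le_iff_ne_zero, Finset.card_ne_zero]
    by_contra hcon
    rw [Finset.not_nonempty_iff_eq_empty] at hcon
    apply hcj
    rw [hc j, hcon, Finset.sum_empty]

theorem shape_bound (r : ℕ) (hr : 2 ≤ r) (s : Fin (r + r) → ℤ) (hs : ∀ i, s i ≠ 0)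
    (hsum : ∑ i, s i = 0) (κ : Fin (r + r) → Fin (r + r)) (ε : ℝ) (hε : 0 < ε) :
    ∃ K : ℝ, 0 < K ∧ ∀ q : ℕ, 0 < q → ∀ lam : ℤ, ∀ V : ℕ, 1 ≤ V → V ^ (4 * r * (r - 1)) ≤ q →
      ∀ S : Finset (Fin (r + r) → ℤ), (∀ v ∈ S, (∀ i, v i ∈ Finset.Icc (-(V : ℤ)) V) ∧
        (∀ i, v (κ i) = v i) ∧ (∀ i j, v i = v j → κ i = κ j) ∧
        (∀ i, IsUnit ((lam + v i : ℤ) : ZMod q)) ∧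
        ∑ i, (s i : ZMod q) * ((lam + v i : ℤ) : ZMod q)⁻¹ = 0) →
      (S.card : ℝ) ≤ K * (V : ℝ) ^ ((r : ℝ) + ε) := by
  classical
  let c : Fin (r + r) → ℤ := fun j => ∑ i ∈ Finset.univ.filter (fun i => κ i = j), s i
  have hcard := shape_card (r + r) s hs κ c (fun j => rfl)
  set m1 := Fintype.card {j // c j ≠ 0} with hm1
  set m0 := Fintype.card {j // κ j = j ∧ c j = 0} with hm0
  have hcsum : ∑ j : {j // c j ≠ 0}, c j = 0 := by
    have h1 : ∑ j, c j = 0 := by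
      rw [← hsum]
      exact Finset.sum_fiberwise Finset.univ κ s
    rw [← Finset.sum_filter_ne_zero Finset.univ (f := c)] at h1
    rw [← Finset.sum_subtype (Finset.univ.filter (fun j => c j ≠ 0)) (by simp) c]
    exact h1
  obtain ⟨K, hK, hA⟩ := lemmaA' r hr (ι := {j // c j ≠ 0}) (by omega) (fun j => c j) (fun j => j.2)
    hcsum ε hε
  refine ⟨K * 3 ^ m0, by positivity, ?_⟩
  intro q hq lam V hV hVq S hS
  have hV1 : (1 : ℝ) ≤ V := by exact_mod_cast hV
  let r1 : (Fin (r + r) → ℤ) → ({j // c j ≠ 0} → ℤ) := fun v j => v j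
  let r0 : (Fin (r + r) → ℤ) → ({j // κ j = j ∧ c j = 0} → ℤ) := fun v j => v j
  have himg : ((S.image r1).card : ℝ) ≤ K * (V : ℝ) ^ ((m1 : ℝ) / 2 + ε) := by
    apply hA q hq lam V hV hVq
    intro w hw
    obtain ⟨v, hv, rfl⟩ := Finset.mem_image.1 hw
    obtain ⟨h1, h2, h3, h4, h5⟩ := hS v hv
    refine ⟨fun i => h1 _, ?_, fun i => h4 _, ?_⟩
    · have hfix : ∀ j : {j // c j ≠ 0}, κ j = j := by
        intro j
        obtain ⟨i, hi, _⟩ := Finset.exists_ne_zero_of_sum_ne_zero j.2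
        rw [Finset.mem_filter] at hi
        have := h3 _ _ (h2 i)
        rw [hi.2] at this
        exact this
      intro j k hjk
      have := h3 _ _ hjk
      rw [hfix, hfix] at this
      exact Subtype.ext this
    · rw [← h5]
      have e1 : ∑ i, (s i : ZMod q) * ((lam + v i : ℤ) : ZMod q)⁻¹ =
          ∑ j, (c j : ZMod q) * ((lam + v j : ℤ) : ZMod q)⁻¹ := by
        rw [← Finset.sum_fiberwise Finset.univ κ]
        refine Finset.sum_congr rfl fun j _ => ?_
        simp only [c]
        rw [Int.cast_sum, Finset.sum_mul]
        refine Finset.sum_congr rfl fun i hi => ?_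
        rw [Finset.mem_filter] at hi
        rw [← hi.2, h2]
      rw [e1]
      rw [← Finset.sum_subset (Finset.filter_subset (fun j => c j ≠ 0) Finset.univ)]
      · symm
        apply Finset.sum_subtype
        simp
      · intro j _ hj
        have : c j = 0 := by simpa using hj
        rw [this]; simp
  have hle : S.card ≤ (S.image r1 ×ˢ Fintype.piFinset
      (fun _ : {j // κ j = j ∧ c j = 0} => Finset.Icc (-(V : ℤ)) V)).card := by
    apply Finset.card_le_card_of_injOn (fun v => (r1 v, r0 v))
    · intro v hv
      have hv' : v ∈ S := hv
      simp only [Finset.mem_coe, Finset.mem_product, Fintype.mem_piFinset]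
      exact ⟨Finset.mem_image_of_mem _ hv', fun i => (hS v hv').1 _⟩
    · intro v hv w hw hvw
      have e1 : r1 v = r1 w := congrArg Prod.fst hvw
      have e0 : r0 v = r0 w := congrArg Prod.snd hvw
      obtain ⟨_, h2, h3, _, _⟩ := hS v hv
      obtain ⟨_, h2', _, _, _⟩ := hS w hw
      funext i
      rw [← h2 i, ← h2' i]
      by_cases hci : c (κ i) = 0
      · exact congrFun e0 ⟨κ i, h3 _ _ (h2 i), hci⟩
      · exact congrFun e1 ⟨κ i, hci⟩
  rw [Finset.card_product, Fintype.card_piFinset] at hle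
  simp only [Int.card_Icc, Finset.prod_const, Finset.card_univ, ← hm0] at hle
  have e3 : ((V : ℤ) + 1 - -(V : ℤ)).toNat = 2 * V + 1 := by omega
  rw [e3] at hle
  have hle' : (S.card : ℝ) ≤ (S.image r1).card * (2 * V + 1) ^ m0 := by exact_mod_cast hle
  have h3V : (2 * (V : ℝ) + 1) ^ m0 ≤ (3 * V) ^ m0 := by
    gcongr
    linarith
  calc (S.card : ℝ) ≤ (S.image r1).card * (2 * V + 1) ^ m0 := hle'
    _ ≤ (K * (V : ℝ) ^ ((m1 : ℝ) / 2 + ε)) * (3 * V) ^ m0 := by gcongr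
    _ = K * 3 ^ m0 * ((V : ℝ) ^ ((m1 : ℝ) / 2 + ε + m0)) := by
        rw [Real.rpow_add (by linarith) _ (m0 : ℝ), Real.rpow_natCast, mul_pow]
        ring
    _ ≤ K * 3 ^ m0 * (V : ℝ) ^ ((r : ℝ) + ε) := by
        have : (m1 : ℝ) + 2 * m0 ≤ r + r := by exact_mod_cast hcard
        refine mul_le_mul_of_nonneg_left (Real.rpow_le_rpow_of_exponent_le hV1 ?_) (by positivity)
        linarith

theorem total_bound (r : ℕ) (hr : 2 ≤ r) (s : Fin (r + r) → ℤ) (hs : ∀ i, s i ≠ 0)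
    (hsum : ∑ i, s i = 0) (ε : ℝ) (hε : 0 < ε) :
    ∃ K : ℝ, 0 < K ∧ ∀ q : ℕ, 0 < q → ∀ lam : ℤ, ∀ V : ℕ, 1 ≤ V → V ^ (4 * r * (r - 1)) ≤ q →
      ∀ S : Finset (Fin (r + r) → ℤ), (∀ v ∈ S, (∀ i, v i ∈ Finset.Icc (-(V : ℤ)) V) ∧
        (∀ i, IsUnit ((lam + v i : ℤ) : ZMod q)) ∧
        ∑ i, (s i : ZMod q) * ((lam + v i : ℤ) : ZMod q)⁻¹ = 0) →
      (S.card : ℝ) ≤ K * (V : ℝ) ^ ((r : ℝ) + ε) := by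
  classical
  have : Nonempty (Fin (r + r)) := ⟨⟨0, by omega⟩⟩
  choose K hK hb using fun κ => shape_bound r hr s hs hsum κ ε hε
  refine ⟨∑ κ, K κ, Finset.sum_pos (fun κ _ => hK κ) Finset.univ_nonempty, ?_⟩
  intro q hq lam V hV hVq S hS
  let key : (Fin (r + r) → ℤ) → (Fin (r + r) → Fin (r + r)) := fun v => Function.invFun v ∘ v
  rw [Finset.card_eq_sum_card_fiberwise (f := key) (t := Finset.univ) (fun i _ => Finset.mem_univ _)]
  push_cast
  rw [Finset.sum_mul]
  refine Finset.sum_le_sum fun κ _ => ?_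
  apply hb κ q hq lam V hV hVq
  intro v hv
  rw [Finset.mem_filter] at hv
  obtain ⟨hv, rfl⟩ := hv
  obtain ⟨h1, h2, h3⟩ := hS v hv
  refine ⟨h1, fun i => Function.invFun_eq ⟨i, rfl⟩, fun i j hij => ?_, h2, h3⟩
  simp only [key, Function.comp_apply, hij]

end KL

/-- Main Kloosterman-fraction counting bound: for `V ≤ q^{1/(4r(r-1))}`,
`K_{r,q}(λ, V) ≤ C(r,ε)·V^r·q^ε`. -/
theorem Kcount_small_range (r : ℕ) (hr : 2 ≤ r) :
    ∀ ε : ℝ, 0 < ε → ∃ Cst : ℝ, 0 < Cst ∧ ∀ q : ℕ, 0 < q → ∀ lam : ℤ, ∀ V : ℕ, 1 ≤ V →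
      (V : ℝ) ≤ (q : ℝ) ^ ((1 : ℝ) / (4 * r * (r - 1))) →
      (Kcount r q lam V : ℝ) ≤ Cst * (V : ℝ) ^ (r : ℕ) * (q : ℝ) ^ ε := by
  classical
  intro ε hε
  let s : Fin (r + r) → ℤ := Fin.addCases (fun _ => 1) (fun _ => -1)
  have hs : ∀ i, s i ≠ 0 := by
    intro i
    induction i using Fin.addCases with
    | left i => simp only [s, Fin.addCases_left]; decide
    | right i => simp only [s, Fin.addCases_right]; decide
  have hsum : ∑ i, s i = 0 := by
    rw [Fin.sum_univ_add]
    simp only [s, Fin.addCases_left, Fin.addCases_right]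
    simp
  obtain ⟨K, hK, hb⟩ := KL.total_bound r hr s hs hsum ε hε
  refine ⟨K, hK, ?_⟩
  intro q hq lam V hV hVq
  have hV1 : (1 : ℝ) ≤ V := by exact_mod_cast hV
  have hkpos : 0 < 4 * r * (r - 1) := by
    have : 0 < r - 1 := by omega
    positivity
  have hkcast : ((4 * r * (r - 1) : ℕ) : ℝ) = 4 * r * (r - 1) := by
    rw [Nat.cast_mul, Nat.cast_sub (by omega)]
    push_cast
    ring
  have hpow : V ^ (4 * r * (r - 1)) ≤ q := by
    have h1 : (V : ℝ) ^ (4 * r * (r - 1)) ≤ ((q : ℝ) ^ ((1 : ℝ) / (4 * r * (r - 1)))) ^ (4 * r * (r - 1)) := by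
      gcongr
    rw [← hkcast, one_div, Real.rpow_inv_natCast_pow (by positivity) (by omega)] at h1
    exact_mod_cast h1
  have hVleq : (V : ℝ) ≤ q := by
    have : V ≤ V ^ (4 * r * (r - 1)) := Nat.le_self_pow (by omega) V
    exact_mod_cast this.trans hpow
  have hmain : (Kcount r q lam V : ℝ) ≤ K * (V : ℝ) ^ ((r : ℝ) + ε) := by
    unfold Kcount
    apply hb q hq lam V hV hpow
    intro v hv
    rw [Finset.mem_filter, Fintype.mem_piFinset] at hv
    obtain ⟨h1, h2, h3⟩ := hv
    refine ⟨h1, h2, ?_⟩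
    rw [Fin.sum_univ_add]
    simp only [s, Fin.addCases_left, Fin.addCases_right]
    simp only [Int.cast_one, one_mul, Int.cast_neg, neg_mul, Finset.sum_neg_distrib]
    rw [h3]
    exact add_neg_cancel _
  refine hmain.trans ?_
  rw [Real.rpow_add (by linarith), Real.rpow_natCast, ← mul_assoc]
  gcongr
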